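/- Let k ≥ 3 and let T be a tournament on k vertices. Then the threshold bias for the T-tournament game on K_n is Θ(n^{2/(k+1)}): there exist constants c, C > 0 and n₀ such that for all n ≥ n₀, Maker has a winning strategy in the (1:b) T-tournament game on K_n whenever b ≤ c·n^{2/(k+1)}, and Breaker has a winning strategy whenever b ≥ C·n^{2/(k+1)}. -/

import Mathlib

namespace TournamentGame

variable {V : Type*} [DecidableEq V]

/-- The underlying undirected edges of a set of oriented edges. -/
def undirect (M : Finset (V × V)) : Finset (Sym2 V) :=
  M.image fun p => s(p.1, p.2)

/-- `MakerWin X F b M B` : in the (1:b) Maker-Breaker game on board `X`, with Maker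
having claimed `M`, Breaker having claimed `B`, and Maker to move, Maker has a strategy
to claim all edges of some winning set (i.e. reach a position with `F` on her edges). -/
inductive MakerWin (X : Finset (Sym2 V)) (F : Finset (Sym2 V) → Prop) (b : ℕ) :
    Finset (Sym2 V) → Finset (Sym2 V) → Prop
  | win (M B : Finset (Sym2 V)) : F M → MakerWin X F b M B
  | move (M B : Finset (Sym2 V)) (e : Sym2 V) (heX : e ∈ X) (hefree : e ∉ M ∪ B)
      (h : ∀ B' : Finset (Sym2 V), B' ⊆ X \ (insert e M ∪ B) →
        B'.card = min b (X \ (insert e M ∪ B)).card →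
        MakerWin X F b (insert e M) (B ∪ B')) :
      MakerWin X F b M B

/-- `BreakerBlock X F b M B` : Maker to move; Breaker has a strategy ensuring that `F`
never holds on Maker's edge set. -/
inductive BreakerBlock (X : Finset (Sym2 V)) (F : Finset (Sym2 V) → Prop) (b : ℕ) :
    Finset (Sym2 V) → Finset (Sym2 V) → Prop
  | step (M B : Finset (Sym2 V)) (hF : ¬ F M) (resp : Sym2 V → Finset (Sym2 V))
      (hsub : ∀ e ∈ X, e ∉ M ∪ B → resp e ⊆ X \ (insert e M ∪ B))
      (hcard : ∀ e ∈ X, e ∉ M ∪ B → (resp e).card = min b (X \ (insert e M ∪ B)).card)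
      (h : ∀ e ∈ X, e ∉ M ∪ B → BreakerBlock X F b (insert e M) (B ∪ resp e)) :
      BreakerBlock X F b M B

/-- Oriented (tournament-game) version of `MakerWin`: Maker claims an edge together with
an orientation; her position is a set of oriented edges. -/
inductive OMakerWin (X : Finset (Sym2 V)) (F : Finset (V × V) → Prop) (b : ℕ) :
    Finset (V × V) → Finset (Sym2 V) → Prop
  | win (M : Finset (V × V)) (B : Finset (Sym2 V)) : F M → OMakerWin X F b M B
  | move (M : Finset (V × V)) (B : Finset (Sym2 V)) (x y : V)
      (heX : s(x, y) ∈ X) (hefree : s(x, y) ∉ undirect M ∪ B)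
      (h : ∀ B' : Finset (Sym2 V), B' ⊆ X \ (insert s(x, y) (undirect M) ∪ B) →
        B'.card = min b (X \ (insert s(x, y) (undirect M) ∪ B)).card →
        OMakerWin X F b (insert (x, y) M) (B ∪ B')) :
      OMakerWin X F b M B

/-- Oriented version of `BreakerBlock`. -/
inductive OBreakerBlock (X : Finset (Sym2 V)) (F : Finset (V × V) → Prop) (b : ℕ) :
    Finset (V × V) → Finset (Sym2 V) → Prop
  | step (M : Finset (V × V)) (B : Finset (Sym2 V)) (hF : ¬ F M)
      (resp : V → V → Finset (Sym2 V))
      (hsub : ∀ x y : V, s(x, y) ∈ X → s(x, y) ∉ undirect M ∪ B →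
        resp x y ⊆ X \ (insert s(x, y) (undirect M) ∪ B))
      (hcard : ∀ x y : V, s(x, y) ∈ X → s(x, y) ∉ undirect M ∪ B →
        (resp x y).card = min b (X \ (insert s(x, y) (undirect M) ∪ B)).card)
      (h : ∀ x y : V, s(x, y) ∈ X → s(x, y) ∉ undirect M ∪ B →
        OBreakerBlock X F b (insert (x, y) M) (B ∪ resp x y)) :
      OBreakerBlock X F b M B

/-- Position with Breaker to move, in the unoriented game: Breaker can respond and
then keep blocking forever. -/
def BreakerTurn (X : Finset (Sym2 V)) (F : Finset (Sym2 V) → Prop) (b : ℕ)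
    (M B : Finset (Sym2 V)) : Prop :=
  ¬ F M ∧ ∃ B' : Finset (Sym2 V), B' ⊆ X \ (M ∪ B) ∧
    B'.card = min b (X \ (M ∪ B)).card ∧ BreakerBlock X F b M (B ∪ B')

/-- Position with Breaker to move, in the oriented game. -/
def OBreakerTurn (X : Finset (Sym2 V)) (F : Finset (V × V) → Prop) (b : ℕ)
    (M : Finset (V × V)) (B : Finset (Sym2 V)) : Prop :=
  ¬ F M ∧ ∃ B' : Finset (Sym2 V), B' ⊆ X \ (undirect M ∪ B) ∧
    B'.card = min b (X \ (undirect M ∪ B)).card ∧ OBreakerBlock X F b M (B ∪ B')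

/-- Winning sets of the triangle game. -/
def HasTriangle (M : Finset (Sym2 V)) : Prop :=
  ∃ x y z : V, x ≠ y ∧ y ≠ z ∧ x ≠ z ∧ s(x, y) ∈ M ∧ s(y, z) ∈ M ∧ s(x, z) ∈ M

/-- Maker's oriented edges contain a cyclic (directed) triangle. -/
def HasCyclicTriangle (M : Finset (V × V)) : Prop :=
  ∃ x y z : V, x ≠ y ∧ y ≠ z ∧ x ≠ z ∧ (x, y) ∈ M ∧ (y, z) ∈ M ∧ (z, x) ∈ M

/-- Maker's oriented edges contain an acyclic (transitive) triangle. -/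
def HasAcyclicTriangle (M : Finset (V × V)) : Prop :=
  ∃ x y z : V, x ≠ y ∧ y ≠ z ∧ x ≠ z ∧ (x, y) ∈ M ∧ (y, z) ∈ M ∧ (x, z) ∈ M

/-- A tournament on `Fin k`, given by its arc relation. -/
def IsTournament {k : ℕ} (T : Fin k → Fin k → Prop) : Prop :=
  (∀ i, ¬ T i i) ∧ ∀ i j : Fin k, i ≠ j → (T i j ↔ ¬ T j i)

/-- Maker's oriented edges contain a copy of the tournament `T`. -/
def HasTCopy {k : ℕ} (T : Fin k → Fin k → Prop) (M : Finset (V × V)) : Prop :=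
  ∃ f : Fin k → V, Function.Injective f ∧ ∀ i j : Fin k, T i j → (f i, f j) ∈ M

/-- The edge set of the complete graph `K_n`. -/
def completeEdges (n : ℕ) : Finset (Sym2 (Fin n)) :=
  Finset.univ.filter fun e => ¬ e.IsDiag

/-- The edge set of the Turán graph `T_{n,k}` : classes are residues mod `k`. -/
def turanEdges (n k : ℕ) : Finset (Sym2 (Fin n)) :=
  Finset.univ.filter fun e => ¬ (e.map fun v : Fin n => v.val % k).IsDiag

/-- `A` contains a good copy of `K_k` (all vertices in distinct classes of `T_{n,k}`). -/
def GoodCopy (n k : ℕ) (A : Finset (Sym2 (Fin n))) : Prop :=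
  ∃ f : Fin k → Fin n, Function.Injective f ∧
    (∀ i j : Fin k, i ≠ j → (f i).val % k ≠ (f j).val % k) ∧
    (∀ i j : Fin k, i ≠ j → s(f i, f j) ∈ A)

open Classical in
/-- Probability that a `p`-random subset `A` of `E` (each element kept independently with
probability `p`) satisfies `P`. This is the model `G(E, p)`. -/
noncomputable def edgeProb {α : Type*} [DecidableEq α] (E : Finset α) (p : ℝ)
    (P : Finset α → Prop) : ℝ :=
  ∑ A ∈ E.powerset, if P A then p ^ A.card * (1 - p) ^ (E.card - A.card) else 0

open Classical in
/-- Probability that a uniformly random `M`-element subset of `E` satisfies `P`.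
This is the model `G(E, M)`. -/
noncomputable def uniformProb {α : Type*} [DecidableEq α] (E : Finset α) (M : ℕ)
    (P : Finset α → Prop) : ℝ :=
  ((E.powerset.filter fun A => A.card = M ∧ P A).card : ℝ) /
    ((E.powerset.filter fun A => A.card = M).card : ℝ)

/-- The three edges of a triangle on `x`, `y`, `z`. -/
def triEdges (x y z : V) : Finset (Sym2 V) := {s(x, y), s(y, z), s(x, z)}

/-- `x`, `y`, `z` form a triangle of the graph with edge set `A`. -/
def IsTriangleIn (A : Finset (Sym2 V)) (x y z : V) : Prop :=
  x ≠ y ∧ y ≠ z ∧ x ≠ z ∧ s(x, y) ∈ A ∧ s(y, z) ∈ A ∧ s(x, z) ∈ A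

/-- The triangles of `A`, each recorded as its set of three edges: the vertex set of `T_A`. -/
def TriSets (A : Finset (Sym2 V)) : Set (Finset (Sym2 V)) :=
  {t | ∃ x y z : V, IsTriangleIn A x y z ∧ t = triEdges x y z}

/-- `C` is a triangle collection: every edge lies in a triangle and the graph `T_C` of
triangles (adjacent iff sharing an edge) is connected. -/
def IsTriangleCollection (C : Finset (Sym2 V)) : Prop :=
  (∀ e ∈ C, ∃ x y z : V, IsTriangleIn C x y z ∧ e ∈ triEdges x y z) ∧
  ∀ t ∈ TriSets C, ∀ t' ∈ TriSets C,
    Relation.ReflTransGen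
      (fun a b => a ∈ TriSets C ∧ b ∈ TriSets C ∧ (a ∩ b).Nonempty) t t'

/-- Adjacency of `K₃⁺`: a triangle on `{0,1,2}` with a pendant edge `{2,3}`. -/
def K3plusAdj (a b : Fin 4) : Prop :=
  (a.val < 3 ∧ b.val < 3 ∧ a ≠ b) ∨ (a.val = 2 ∧ b.val = 3) ∨ (a.val = 3 ∧ b.val = 2)

/-- Adjacency of the path on `Fin m`. -/
def pathAdj {m : ℕ} (a b : Fin m) : Prop := a.val + 1 = b.val ∨ b.val + 1 = a.val

/-- `C` is very basic: `T_C` is (isomorphic to) a subgraph of `K₃⁺` or of a path `P_m`. -/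
def VeryBasic (C : Finset (Sym2 V)) : Prop :=
  (∃ φ : TriSets C → Fin 4, Function.Injective φ ∧
    ∀ t t' : TriSets C, t ≠ t' → ((t : Finset (Sym2 V)) ∩ (t' : Finset (Sym2 V))).Nonempty →
      K3plusAdj (φ t) (φ t')) ∨
  (∃ m : ℕ, ∃ φ : TriSets C → Fin m, Function.Injective φ ∧
    ∀ t t' : TriSets C, t ≠ t' → ((t : Finset (Sym2 V)) ∩ (t' : Finset (Sym2 V))).Nonempty →
      pathAdj (φ t) (φ t'))

/-- `C` is basic: there are distinct edges `e₁, e₂` with `C - eᵢ` very basic for both. -/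
def Basic (C : Finset (Sym2 V)) : Prop :=
  ∃ e₁ ∈ C, ∃ e₂ ∈ C, e₁ ≠ e₂ ∧ VeryBasic (C.erase e₁) ∧ VeryBasic (C.erase e₂)

open Classical in
/-- The set of non-isolated vertices of the graph with edge set `C`. -/
noncomputable def support [Fintype V] (C : Finset (Sym2 V)) : Finset V :=
  Finset.univ.filter fun v => ∃ e ∈ C, v ∈ e

open Classical in
/-- Degree of `v` in the graph with edge set `C`. -/
noncomputable def degreeIn (C : Finset (Sym2 V)) (v : V) : ℕ :=
  (C.filter fun e => v ∈ e).card

/-- The maximum density `m(C) = max_{H ⊆ C} e(H)/v(H)` is (strictly) less than `r`. -/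
def MaxDensityLt [Fintype V] (C : Finset (Sym2 V)) (r : ℝ) : Prop :=
  ∀ D ⊆ C, D.Nonempty → (D.card : ℝ) / ((support D).card : ℝ) < r

/-- The edge set of the `k`-wheel: a cycle on `{0, …, k-1} ⊆ Fin (k+1)` together with
all edges to the center, the vertex `k`. -/
def wheelEdges (k : ℕ) : Finset (Sym2 (Fin (k + 1))) :=
  ((Finset.univ : Finset (Fin k)).image fun i =>
    s((⟨i.val, by have := i.2; omega⟩ : Fin (k + 1)),
      (⟨(i.val + 1) % k, by have := i.2; exact Nat.lt_succ_of_lt (Nat.mod_lt _ (by omega))⟩ :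
        Fin (k + 1)))) ∪
  ((Finset.univ : Finset (Fin k)).image fun i =>
    s((⟨i.val, by have := i.2; omega⟩ : Fin (k + 1)), (Fin.last k)))

section Potential

variable {E Λ : Type*} [DecidableEq E]

/-- Total weight of the sets `A l`, `l ∈ L`, not touched by Breaker, where a set with `r`
elements missing from Maker's position has weight `(1 + q)⁻¹ ^ r`. -/
noncomputable def danger (L : Finset Λ) (A : Λ → Finset E) (q : ℕ) (M B : Finset E) : ℝ :=
  ∑ l ∈ L with Disjoint (A l) B, ((1 + q : ℝ)⁻¹) ^ (A l \ M).card

/-- The part of the danger coming from the sets containing `e`. -/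
noncomputable def dangerAt (L : Finset Λ) (A : Λ → Finset E) (q : ℕ) (M B : Finset E) (e : E) : ℝ :=
  ∑ l ∈ L with Disjoint (A l) B, if e ∈ A l then ((1 + q : ℝ)⁻¹) ^ (A l \ M).card else 0

lemma dangerAt_le_danger (L : Finset Λ) (A : Λ → Finset E) (q : ℕ) (M B : Finset E) (e : E) :
    dangerAt L A q M B e ≤ danger L A q M B := by
  refine Finset.sum_le_sum fun l _ => ?_
  split_ifs
  · exact le_rfl
  · positivity

lemma danger_anti (L : Finset Λ) (A : Λ → Finset E) (q : ℕ) (M : Finset E) {B B' : Finset E}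
    (h : B ⊆ B') : danger L A q M B' ≤ danger L A q M B := by
  refine Finset.sum_le_sum_of_subset_of_nonneg ?_ fun l _ _ => by positivity
  intro l hl
  simp only [Finset.mem_filter] at hl ⊢
  exact ⟨hl.1, hl.2.mono_right h⟩

lemma dangerAt_anti (L : Finset Λ) (A : Λ → Finset E) (q : ℕ) (M : Finset E) {B B' : Finset E}
    (h : B ⊆ B') (e : E) : dangerAt L A q M B' e ≤ dangerAt L A q M B e := by
  refine Finset.sum_le_sum_of_subset_of_nonneg ?_ fun l _ _ => by split_ifs <;> positivity
  intro l hl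
  simp only [Finset.mem_filter] at hl ⊢
  exact ⟨hl.1, hl.2.mono_right h⟩

lemma danger_insert_maker (L : Finset Λ) (A : Λ → Finset E) (q : ℕ) (M B : Finset E) {e : E}
    (he : e ∉ M) : danger L A q (insert e M) B = danger L A q M B + q * dangerAt L A q M B e := by
  unfold danger dangerAt
  rw [Finset.mul_sum, ← Finset.sum_add_distrib]
  refine Finset.sum_congr rfl fun l _ => ?_
  split_ifs with h
  · have h1 : A l \ M = insert e (A l \ insert e M) := by
      ext x; simp only [Finset.mem_sdiff, Finset.mem_insert]; grind
    have h2 : e ∉ A l \ insert e M := by simp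
    rw [h1, Finset.card_insert_of_notMem h2, pow_succ]
    have : (1 + q : ℝ) ≠ 0 := by positivity
    field_simp
  · have h1 : A l \ insert e M = A l \ M := by
      ext x; simp only [Finset.mem_sdiff, Finset.mem_insert]; grind
    rw [h1]; ring

lemma danger_insert_breaker (L : Finset Λ) (A : Λ → Finset E) (q : ℕ) (M B : Finset E) (e : E) :
    danger L A q M (insert e B) = danger L A q M B - dangerAt L A q M B e := by
  unfold danger dangerAt
  rw [← Finset.sum_sub_distrib, Finset.sum_filter, Finset.sum_filter]
  refine Finset.sum_congr rfl fun l _ => ?_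
  by_cases h1 : Disjoint (A l) B <;> by_cases h2 : e ∈ A l <;> simp [h1, h2]

/-- Greedy response: `j` further elements suffice to compensate for `j` times the
danger at any remaining element. -/
lemma exists_greedy_response (L : Finset Λ) (A : Λ → Finset E) (q : ℕ) (M B X : Finset E) (j : ℕ) :
    ∃ R ⊆ X \ (M ∪ B), R.card ≤ j ∧ ∀ e ∈ X \ (M ∪ (B ∪ R)),
      danger L A q M (B ∪ R) + j * dangerAt L A q M (B ∪ R) e ≤ danger L A q M B := by
  induction j with
  | zero => exact ⟨∅, by simp, by simp, by simp⟩
  | succ j ih =>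
    obtain ⟨R, hR, hc, h⟩ := ih
    rcases (X \ (M ∪ (B ∪ R))).eq_empty_or_nonempty with h0 | h0
    · exact ⟨R, hR, by omega, by simp [h0]⟩
    obtain ⟨f, hf, hmax⟩ := Finset.exists_max_image _ (dangerAt L A q M (B ∪ R)) h0
    have hU : B ∪ insert f R = insert f (B ∪ R) := by
      ext; simp only [Finset.mem_union, Finset.mem_insert]; tauto
    refine ⟨insert f R, ?_, (Finset.card_insert_le _ _).trans (by omega), fun e he => ?_⟩
    · refine Finset.insert_subset ?_ hR
      simp only [Finset.mem_sdiff, Finset.mem_union] at hf ⊢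
      tauto
    · rw [hU] at he ⊢
      have he' : e ∈ X \ (M ∪ (B ∪ R)) := by
        simp only [Finset.mem_sdiff, Finset.mem_union, Finset.mem_insert] at he ⊢; tauto
      have h1 := dangerAt_anti L A q M (Finset.subset_insert f (B ∪ R)) e
      have h2 := hmax e he'
      have h3 := h f hf
      rw [danger_insert_breaker]
      push_cast
      have : (j + 1 : ℝ) * dangerAt L A q M (insert f (B ∪ R)) e ≤
          (j + 1) * dangerAt L A q M (B ∪ R) f := by gcongr; linarith
      linarith

/-- Potential strategy for Breaker: with `q` elements he makes sure that Maker's next move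
does not raise the danger above its current value. -/
lemma exists_response (L : Finset Λ) (A : Λ → Finset E) (q : ℕ) (M B X : Finset E) :
    ∃ R ⊆ X \ (M ∪ B), R.card ≤ q ∧ ∀ B', B ∪ R ⊆ B' → ∀ e ∈ X \ (M ∪ B'),
      danger L A q (insert e M) B' ≤ danger L A q M B := by
  obtain ⟨R, hR, hc, h⟩ := exists_greedy_response L A q M B X q
  refine ⟨R, hR, hc, fun B' hB' e he => ?_⟩
  have he' : e ∈ X \ (M ∪ (B ∪ R)) := by
    simp only [Finset.mem_sdiff, Finset.mem_union] at he ⊢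
    refine ⟨he.1, fun h => he.2 (h.imp id fun h => hB' (by simpa using h))⟩
  have heM : e ∉ M := by
    simp only [Finset.mem_sdiff, Finset.mem_union] at he; tauto
  rw [danger_insert_maker _ _ _ _ _ heM]
  have h1 := danger_anti L A q M hB'
  have h2 := dangerAt_anti L A q M hB' e
  have h3 : (q : ℝ) * dangerAt L A q M B' e ≤ q * dangerAt L A q M (B ∪ R) e := by gcongr
  linarith [h e he']

/-- Moment bound: `Lv r U` is meant to say that `U` is the union of so few of the sets `A α`
that `r` more may be added. -/
lemma sum_pow_card_biUnion_le {α : Type*} (S : Finset α) (A : α → Finset E) (p lam : ℝ)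
    (hlam : 0 ≤ lam) (hp : 0 ≤ p)
    (Lv : ℕ → Finset E → Prop) (hstep : ∀ r U, Lv (r + 1) U → ∀ a ∈ S, Lv r (U ∪ A a))
    (hsum : ∀ r U, Lv (r + 1) U → ∑ a ∈ S, p ^ (A a \ U).card ≤ lam) (r : ℕ) :
    ∀ U, Lv r U → ∑ c ∈ Fintype.piFinset (fun _ : Fin r => S),
      p ^ ((Finset.univ.biUnion fun i => A (c i)) \ U).card ≤ lam ^ r := by
  induction r with
  | zero => intro U _; simp
  | succ r ih =>
    intro U hU
    have key : ∑ c ∈ Fintype.piFinset (fun _ : Fin (r + 1) => S),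
        p ^ ((Finset.univ.biUnion fun i => A (c i)) \ U).card =
        ∑ a ∈ S, ∑ c ∈ Fintype.piFinset (fun _ : Fin r => S),
          p ^ (A a \ U).card *
            p ^ ((Finset.univ.biUnion fun i => A (c i)) \ (U ∪ A a)).card := by
      rw [← Finset.sum_product']
      refine Finset.sum_bij' (fun c _ => (c 0, fun i => c i.succ))
        (fun x _ => Fin.cons x.1 x.2) ?_ ?_ ?_ ?_ ?_
      · intro c hc
        simp only [Fintype.mem_piFinset, Finset.mem_product] at hc ⊢
        exact ⟨hc 0, fun i => hc _⟩
      · intro x hx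
        simp only [Fintype.mem_piFinset, Finset.mem_product] at hx ⊢
        exact Fin.cases (by simpa using hx.1) (fun i => by simpa using hx.2 i)
      · intro c _; ext i; exact Fin.cases rfl (fun i => rfl) i
      · intro x _; simp
      · intro c _
        rw [← pow_add, ← Finset.card_union_of_disjoint]
        · congr 2
          ext x
          simp only [Finset.mem_sdiff, Finset.mem_biUnion, Finset.mem_univ, true_and,
            Finset.mem_union, Fin.exists_fin_succ]
          tauto
        · rw [Finset.disjoint_left]
          intro x hx
          simp only [Finset.mem_sdiff, Finset.mem_union] at hx ⊢
          tauto
    rw [key]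
    calc _ ≤ ∑ a ∈ S, p ^ (A a \ U).card * lam ^ r := by
          refine Finset.sum_le_sum fun a ha => ?_
          rw [← Finset.mul_sum]
          exact mul_le_mul_of_nonneg_left (ih _ (hstep r U hU a ha)) (by positivity)
      _ ≤ lam ^ (r + 1) := by
          rw [← Finset.sum_mul, pow_succ, mul_comm]
          exact mul_le_mul_of_nonneg_left (hsum r U hU) (by positivity)

end Potential

section BreakerGame

/-- The edges of the complete graph on `S`. -/
def cliqueEdges (S : Finset V) : Finset (Sym2 V) := S.offDiag.image (Function.uncurry Sym2.mk)

lemma mk_mem_cliqueEdges {S : Finset V} {x y : V} :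
    s(x, y) ∈ cliqueEdges S ↔ x ∈ S ∧ y ∈ S ∧ x ≠ y := by
  simp only [cliqueEdges, Finset.mem_image, Finset.mem_offDiag, Prod.exists,
    Function.uncurry_apply_pair, Sym2.eq_iff]
  constructor
  · rintro ⟨a, b, ⟨ha, hb, hab⟩, ⟨rfl, rfl⟩ | ⟨rfl, rfl⟩⟩
    · exact ⟨ha, hb, hab⟩
    · exact ⟨hb, ha, hab.symm⟩
  · rintro ⟨hx, hy, hxy⟩
    exact ⟨x, y, ⟨hx, hy, hxy⟩, Or.inl ⟨rfl, rfl⟩⟩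

lemma card_cliqueEdges (S : Finset V) : (cliqueEdges S).card = S.card.choose 2 :=
  Sym2.card_image_offDiag S

lemma cliqueEdges_inter (S W : Finset V) :
    cliqueEdges S ∩ cliqueEdges W = cliqueEdges (S ∩ W) := by
  ext e
  induction e with
  | _ x y => simp only [Finset.mem_inter, mk_mem_cliqueEdges]; tauto

lemma cliqueEdges_mono {S W : Finset V} (h : S ⊆ W) : cliqueEdges S ⊆ cliqueEdges W := by
  intro e
  induction e with
  | _ x y => simp only [mk_mem_cliqueEdges]; exact fun ⟨a, b, c⟩ => ⟨h a, h b, c⟩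

lemma breakerBlock_of_invariant (X : Finset (Sym2 V)) (F : Finset (V × V) → Prop) (b : ℕ)
    (Inv : Finset (Sym2 V) → Finset (Sym2 V) → Prop)
    (hF : ∀ M B, Inv (undirect M) B → ¬ F M)
    (hresp : ∀ M B, Inv M B → ∀ e ∈ X, e ∉ M ∪ B → ∃ R ⊆ X \ (insert e M ∪ B),
      R.card = min b (X \ (insert e M ∪ B)).card ∧ Inv (insert e M) (B ∪ R))
    (M : Finset (V × V)) (B : Finset (Sym2 V)) (h : Inv (undirect M) B) :
    OBreakerBlock X F b M B := by
  induction hn : (X \ (undirect M ∪ B)).card using Nat.strong_induction_on generalizing M B with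
  | _ n ih =>
    have hr := hresp (undirect M) B h
    choose! R hR using hr
    refine .step M B (hF M B h) (fun x y => R s(x, y)) (fun x y hx hy => (hR _ hx hy).1)
      (fun x y hx hy => (hR _ hx hy).2.1) (fun x y hx hy => ?_)
    have hu : undirect (insert (x, y) M) = insert s(x, y) (undirect M) := by
      simp [undirect, Finset.image_insert]
    refine ih _ ?_ _ _ (by rw [hu]; exact (hR _ hx hy).2.2) rfl
    rw [← hn, hu]
    refine Finset.card_lt_card (Finset.ssubset_iff_subset_ne.2 ⟨?_, fun heq => ?_⟩)
    · refine Finset.sdiff_subset_sdiff le_rfl ?_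
      exact Finset.union_subset_union (Finset.subset_insert _ _) Finset.subset_union_left
    · have : s(x, y) ∈ X \ (undirect M ∪ B) := Finset.mem_sdiff.2 ⟨hx, hy⟩
      rw [← heq] at this
      simp at this

variable [Fintype V]

/-- Pairs `(S, f)` where `S` is a `k`-set spanning `e` and `f ≠ e` is an edge inside `S`. -/
def pieces (k : ℕ) (e : Sym2 V) : Finset (Finset V × Sym2 V) :=
  Finset.univ.filter fun a =>
    a.1.card = k ∧ e ∈ cliqueEdges a.1 ∧ a.2 ∈ cliqueEdges a.1 ∧ a.2 ≠ e

/-- The edges which together with `e` make `f` a threat, for `a = (S, f)`. -/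
def piece (e : Sym2 V) (a : Finset V × Sym2 V) : Finset (Sym2 V) :=
  ((cliqueEdges a.1).erase e).erase a.2

/-- Index set of the `t`-tuples of pieces with a common root in `X`. -/
def pieceTuples (X : Finset (Sym2 V)) (k t : ℕ) :
    Finset (Σ _ : Sym2 V, Fin t → Finset V × Sym2 V) :=
  X.sigma fun e => Fintype.piFinset fun _ => pieces k e

/-- Union of a tuple of pieces. -/
def pieceUnion {t : ℕ} (l : Σ _ : Sym2 V, Fin t → Finset V × Sym2 V) : Finset (Sym2 V) :=
  Finset.univ.biUnion fun i => piece l.1 (l.2 i)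

lemma card_pow_le_danger (X : Finset (Sym2 V)) (k t q : ℕ) {M B : Finset (Sym2 V)}
    (hMB : Disjoint M B) {e : Sym2 V} (he : e ∈ X) :
    (((pieces k e).filter fun a => piece e a ⊆ M).card : ℝ) ^ t ≤
      danger (pieceTuples X k t) pieceUnion q M B := by
  set Q := (pieces k e).filter fun a => piece e a ⊆ M
  have h1 : ((Q.card : ℝ)) ^ t =
      ∑ l ∈ (Fintype.piFinset fun _ : Fin t => Q).map
        ⟨Sigma.mk (β := fun _ : Sym2 V => Fin t → Finset V × Sym2 V) e, sigma_mk_injective⟩,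
        ((1 + q : ℝ)⁻¹) ^ (pieceUnion l \ M).card := by
    rw [Finset.sum_map, Finset.sum_congr rfl (g := fun _ => (1 : ℝ))]
    · simp [Fintype.card_piFinset]
    · intro c hc
      have : pieceUnion ⟨e, c⟩ \ M = ∅ := by
        rw [Finset.sdiff_eq_empty_iff_subset]
        refine Finset.biUnion_subset.2 fun i _ => ?_
        exact (Finset.mem_filter.1 (Fintype.mem_piFinset.1 hc i)).2
      simp [this]
  rw [h1]
  refine Finset.sum_le_sum_of_subset_of_nonneg ?_ fun _ _ _ => by positivity
  intro l hl
  simp only [Finset.mem_map, Function.Embedding.coeFn_mk] at hl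
  obtain ⟨c, hc, rfl⟩ := hl
  refine Finset.mem_filter.2 ⟨Finset.mem_sigma.2 ⟨he, Fintype.mem_piFinset.2 fun i => ?_⟩, ?_⟩
  · exact (Finset.mem_filter.1 (Fintype.mem_piFinset.1 hc i)).1
  · refine hMB.mono_left (Finset.biUnion_subset.2 fun i _ => ?_)
    exact (Finset.mem_filter.1 (Fintype.mem_piFinset.1 hc i)).2

/-- Breaker avoids all `k`-cliques as soon as the initial potential is small. -/
theorem breaker_clique (X : Finset (Sym2 V)) (F : Finset (V × V) → Prop) (k t q b : ℕ)
    (hk : 3 ≤ k) (hF : ∀ M, F M → ∃ S : Finset V, S.card = k ∧ cliqueEdges S ⊆ undirect M)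
    (hb : 2 * q ≤ b)
    (hpot : (1 + q : ℝ) * danger (pieceTuples X k t) pieceUnion q ∅ ∅ < (1 + q) ^ t) :
    OBreakerBlock X F b ∅ ∅ := by
  classical
  set D := danger (pieceTuples X k t) pieceUnion q with hD
  let Inv : Finset (Sym2 V) → Finset (Sym2 V) → Prop := fun M B =>
    Disjoint M B ∧ (∀ S : Finset V, S.card = k → ¬ cliqueEdges S ⊆ M) ∧
    (∀ S : Finset V, S.card = k → ∀ f ∈ cliqueEdges S, f ∈ X \ (M ∪ B) → ¬ (cliqueEdges S).erase f ⊆ M) ∧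
    ∀ e ∈ X \ (M ∪ B), D (insert e M) B < (1 + q) ^ t
  refine breakerBlock_of_invariant X F b Inv ?_ ?_ ∅ ∅ ?_
  · rintro M B ⟨-, h, -⟩ hM
    obtain ⟨S, hS, hSM⟩ := hF M hM
    exact h S hS hSM
  · rintro M B ⟨hMB, hno, hthreat, hpot⟩ e heX he
    have heM : e ∉ M := fun h => he (by simp [h])
    have heB : e ∉ B := fun h => he (by simp [h])
    have hDe := hpot e (Finset.mem_sdiff.2 ⟨heX, he⟩)
    have hMB' : Disjoint (insert e M) B := Finset.disjoint_insert_left.2 ⟨heB, hMB⟩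
    set M' := insert e M with hM'
    set Th := (X \ (M' ∪ B)).filter fun f =>
      ∃ S : Finset V, S.card = k ∧ f ∈ cliqueEdges S ∧ (cliqueEdges S).erase f ⊆ M' with hTh
    have hThsub : Th ⊆ ((pieces k e).filter fun a => piece e a ⊆ M').image Prod.snd := by
      intro f hf
      obtain ⟨hfX, S, hS, hfS, hSM⟩ := Finset.mem_filter.1 hf
      have hfX' := (Finset.mem_sdiff.1 hfX).2
      have hfe : f ≠ e := by rintro rfl; exact hfX' (by simp [hM'])
      refine Finset.mem_image.2 ⟨(S, f), Finset.mem_filter.2 ⟨?_, ?_⟩, rfl⟩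
      · refine Finset.mem_filter.2 ⟨Finset.mem_univ _, hS, ?_, hfS, hfe⟩
        by_contra heS
        refine hthreat S hS f hfS (Finset.mem_sdiff.2 ⟨(Finset.mem_sdiff.1 hfX).1,
          fun h => hfX' ?_⟩) fun x hx => ?_
        · rcases Finset.mem_union.1 h with h | h <;> simp [hM', h]
        · rcases Finset.mem_insert.1 (hSM hx) with rfl | h
          · exact absurd (Finset.mem_of_mem_erase hx) heS
          · exact h
      · refine subset_trans ?_ hSM
        exact Finset.erase_subset_erase _ (Finset.erase_subset _ _)
    have hThcard : Th.card ≤ q := by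
      have h1 := (Finset.card_le_card hThsub).trans Finset.card_image_le
      have h2 := (card_pow_le_danger X k t q hMB' heX).trans_lt hDe
      have h3 := lt_of_pow_lt_pow_left₀ t (by positivity) h2
      have h4 : ((pieces k e).filter fun a => piece e a ⊆ M').card < 1 + q := by exact_mod_cast h3
      omega
    obtain ⟨R₀, hR₀, hR₀c, hR₀D⟩ :=
      exists_response (pieceTuples X k t) pieceUnion q M' B X
    have hUsub : R₀ ∪ Th ⊆ X \ (M' ∪ B) := Finset.union_subset hR₀ (Finset.filter_subset _ _)
    have hUcard : (R₀ ∪ Th).card ≤ min b (X \ (M' ∪ B)).card :=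
      le_min ((Finset.card_union_le _ _).trans (by omega)) (Finset.card_le_card hUsub)
    obtain ⟨R, hUR, hRX, hRc⟩ := Finset.exists_subsuperset_card_eq hUsub hUcard (min_le_right _ _)
    refine ⟨R, hRX, hRc, ?_, ?_, ?_, ?_⟩
    · refine Finset.disjoint_union_right.2 ⟨hMB', ?_⟩
      refine Finset.disjoint_left.2 fun x hx hxR => ?_
      exact (Finset.mem_sdiff.1 (hRX hxR)).2 (Finset.mem_union_left _ hx)
    · intro S hS hSM
      have heS : e ∈ cliqueEdges S := by
        by_contra heS
        refine hno S hS fun x hx => ?_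
        rcases Finset.mem_insert.1 (hSM hx) with rfl | h
        · exact absurd hx heS
        · exact h
      refine hthreat S hS e heS (Finset.mem_sdiff.2 ⟨heX, he⟩) fun x hx => ?_
      exact (Finset.mem_insert.1 (hSM (Finset.mem_of_mem_erase hx))).resolve_left
        (Finset.ne_of_mem_erase hx)
    · intro S hS f hfS hf hSM
      have hf' := Finset.mem_sdiff.1 hf
      refine hf'.2 (Finset.mem_union_right _ (Finset.mem_union_right _ (hUR ?_)))
      refine Finset.mem_union_right _ (Finset.mem_filter.2 ⟨?_, S, hS, hfS, hSM⟩)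
      refine Finset.mem_sdiff.2 ⟨hf'.1, fun h => hf'.2 ?_⟩
      exact Finset.union_subset_union le_rfl Finset.subset_union_left h
    · intro f hf
      refine lt_of_le_of_lt (hR₀D (B ∪ R) ?_ f hf) hDe
      exact Finset.union_subset_union le_rfl (Finset.subset_union_left.trans hUR)
  · have hS3 : ∀ S : Finset V, S.card = k → 3 ≤ (cliqueEdges S).card := fun S hS => by
      rw [card_cliqueEdges, hS]
      exact (by decide : 3 ≤ Nat.choose 3 2).trans (Nat.choose_le_choose 2 hk)
    refine ⟨by simp [undirect], fun S hS h => ?_, fun S hS f hf _ h => ?_, fun e _ => ?_⟩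
    · have := hS3 S hS
      have := Finset.card_le_card h
      simp only [undirect, Finset.image_empty, Finset.card_empty] at this
      omega
    · have := hS3 S hS
      have := Finset.card_le_card h
      simp only [undirect, Finset.image_empty, Finset.card_empty,
        Finset.card_erase_of_mem hf] at this
      omega
    · refine lt_of_le_of_lt ?_ hpot
      simp only [undirect, Finset.image_empty]
      rw [hD, danger_insert_maker _ _ _ _ _ (Finset.notMem_empty e)]
      have := dangerAt_le_danger (pieceTuples X k t) pieceUnion q ∅ ∅ e
      have : (q : ℝ) * dangerAt (pieceTuples X k t) pieceUnion q ∅ ∅ e ≤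
        q * danger (pieceTuples X k t) pieceUnion q ∅ ∅ := by gcongr
      linarith

end BreakerGame

section BreakerMoment

variable [Fintype V]

lemma card_sets_inter_le {k j w : ℕ} {x y : V} (hxy : x ≠ y) {W : Finset V} (hx : x ∈ W)
    (hy : y ∈ W) (hw : W.card ≤ w) :
    ((Finset.univ : Finset (Finset V)).filter fun S =>
      (S.card = k ∧ s(x, y) ∈ cliqueEdges S) ∧ (S ∩ W).card = j).card ≤
      w ^ (j - 2) * Fintype.card V ^ (k - j) := by
  have hmaps : ∀ S ∈ (Finset.univ : Finset (Finset V)).filter (fun S =>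
      (S.card = k ∧ s(x, y) ∈ cliqueEdges S) ∧ (S ∩ W).card = j),
      ((S ∩ W) \ {x, y}, S \ W) ∈
        Finset.powersetCard (j - 2) W ×ˢ Finset.powersetCard (k - j) (Finset.univ : Finset V) := by
    intro S hS
    obtain ⟨-, ⟨hSk, hSe⟩, hSj⟩ := Finset.mem_filter.1 hS
    obtain ⟨hxS, hyS, -⟩ := mk_mem_cliqueEdges.1 hSe
    refine Finset.mem_product.2 ⟨Finset.mem_powersetCard.2 ⟨?_, ?_⟩,
      Finset.mem_powersetCard.2 ⟨Finset.subset_univ _, ?_⟩⟩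
    · exact Finset.sdiff_subset.trans Finset.inter_subset_right
    · rw [Finset.card_sdiff_of_subset, hSj, Finset.card_pair hxy]
      intro z hz
      rcases Finset.mem_insert.1 hz with rfl | hz
      · exact Finset.mem_inter.2 ⟨hxS, hx⟩
      · rw [Finset.mem_singleton.1 hz]
        exact Finset.mem_inter.2 ⟨hyS, hy⟩
    · have := Finset.card_inter_add_card_sdiff S W
      simp only
      omega
  refine (Finset.card_le_card_of_injOn _ hmaps ?_).trans ?_
  · intro S hS S' hS' h
    obtain ⟨-, ⟨-, hSe⟩, -⟩ := Finset.mem_filter.1 (Finset.mem_coe.1 hS)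
    obtain ⟨-, ⟨-, hSe'⟩, -⟩ := Finset.mem_filter.1 (Finset.mem_coe.1 hS')
    obtain ⟨hxS, hyS, -⟩ := mk_mem_cliqueEdges.1 hSe
    obtain ⟨hxS', hyS', -⟩ := mk_mem_cliqueEdges.1 hSe'
    simp only [Prod.mk.injEq, Finset.ext_iff, Finset.mem_sdiff, Finset.mem_inter,
      Finset.mem_insert, Finset.mem_singleton] at h
    ext z
    have h1 := h.1 z
    have h2 := h.2 z
    by_cases hzx : z = x
    · subst hzx; tauto
    by_cases hzy : z = y
    · subst hzy; tauto
    tauto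
  · rw [Finset.card_product, Finset.card_powersetCard, Finset.card_powersetCard]
    refine Nat.mul_le_mul ((Nat.choose_le_pow _ _).trans ?_) ?_
    · exact Nat.pow_le_pow_left hw _
    · exact Nat.choose_le_pow _ _

lemma le_card_piece_sdiff {k : ℕ} {e : Sym2 V} {W : Finset V} {U : Finset (Sym2 V)}
    (heW : e ∈ cliqueEdges W) (hU : U ⊆ cliqueEdges W) {a : Finset V × Sym2 V}
    (ha : a ∈ pieces k e) :
    k.choose 2 - (a.1 ∩ W).card.choose 2 - 1 ≤ (piece e a \ U).card := by
  obtain ⟨-, hk, -, -, -⟩ := Finset.mem_filter.1 ha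
  have hsub : (cliqueEdges a.1 \ cliqueEdges (a.1 ∩ W)).erase a.2 ⊆ piece e a \ U := by
    intro z hz
    rw [← cliqueEdges_inter] at hz
    simp only [Finset.mem_erase, Finset.mem_sdiff, Finset.mem_inter, not_and] at hz
    refine Finset.mem_sdiff.2 ⟨Finset.mem_erase.2 ⟨hz.1, Finset.mem_erase.2 ⟨?_, hz.2.1⟩⟩, ?_⟩
    · rintro rfl; exact hz.2.2 hz.2.1 heW
    · exact fun h => hz.2.2 hz.2.1 (hU h)
  refine le_trans ?_ (Finset.card_le_card hsub)
  refine le_trans ?_ Finset.pred_card_le_card_erase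
  rw [Finset.card_sdiff_of_subset (cliqueEdges_mono Finset.inter_subset_left),
    card_cliqueEdges, card_cliqueEdges, hk]

lemma sum_pieces_le {k w : ℕ} {p : ℝ} (hp0 : 0 ≤ p) (hp1 : p ≤ 1) {e : Sym2 V} {W : Finset V}
    {U : Finset (Sym2 V)} (heW : e ∈ cliqueEdges W) (hU : U ⊆ cliqueEdges W) (hw : W.card ≤ w) :
    ∑ a ∈ pieces k e, p ^ (piece e a \ U).card ≤
      k.choose 2 * ∑ j ∈ Finset.Icc 2 k,
        (w : ℝ) ^ (j - 2) * (Fintype.card V : ℝ) ^ (k - j) *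
          p ^ (k.choose 2 - j.choose 2 - 1) := by
  induction e with
  | _ x y =>
  set 𝒮 := (Finset.univ : Finset (Finset V)).filter fun S => S.card = k ∧ s(x, y) ∈ cliqueEdges S
    with h𝒮
  obtain ⟨hx, hy, hxy⟩ := mk_mem_cliqueEdges.1 heW
  calc ∑ a ∈ pieces k s(x, y), p ^ (piece s(x, y) a \ U).card
      ≤ ∑ a ∈ pieces k s(x, y), p ^ (k.choose 2 - (a.1 ∩ W).card.choose 2 - 1) :=
        Finset.sum_le_sum fun a ha =>
          pow_le_pow_of_le_one hp0 hp1 (le_card_piece_sdiff heW hU ha)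
    _ = ∑ S ∈ 𝒮, ∑ a ∈ pieces k s(x, y) with a.1 = S,
          p ^ (k.choose 2 - (a.1 ∩ W).card.choose 2 - 1) := by
        refine (Finset.sum_fiberwise_of_maps_to (fun a ha => ?_) _).symm
        obtain ⟨-, hk, he, -, -⟩ := Finset.mem_filter.1 ha
        exact Finset.mem_filter.2 ⟨Finset.mem_univ _, hk, he⟩
    _ ≤ ∑ S ∈ 𝒮, k.choose 2 * p ^ (k.choose 2 - (S ∩ W).card.choose 2 - 1) := by
        refine Finset.sum_le_sum fun S hS => ?_
        rw [Finset.sum_congr rfl (g := fun _ => p ^ (k.choose 2 - (S ∩ W).card.choose 2 - 1))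
          (fun a ha => by rw [(Finset.mem_filter.1 ha).2]), Finset.sum_const, nsmul_eq_mul]
        refine mul_le_mul_of_nonneg_right ?_ (by positivity)
        have : ((pieces k s(x, y)).filter fun a => a.1 = S).card ≤ (cliqueEdges S).card := by
          refine Finset.card_le_card_of_injOn Prod.snd (fun a ha => ?_) fun a ha b hb hab => ?_
          · obtain ⟨hap, haS⟩ := Finset.mem_filter.1 (Finset.mem_coe.1 ha)
            exact haS ▸ (Finset.mem_filter.1 hap).2.2.2.1
          · exact Prod.ext ((Finset.mem_filter.1 (Finset.mem_coe.1 ha)).2.trans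
              (Finset.mem_filter.1 (Finset.mem_coe.1 hb)).2.symm) hab
        rw [card_cliqueEdges, (Finset.mem_filter.1 hS).2.1] at this
        exact_mod_cast this
    _ = k.choose 2 * ∑ j ∈ Finset.Icc 2 k, ∑ S ∈ 𝒮 with (S ∩ W).card = j,
          p ^ (k.choose 2 - (S ∩ W).card.choose 2 - 1) := by
        rw [← Finset.mul_sum, Finset.sum_fiberwise_of_maps_to]
        intro S hS
        obtain ⟨-, hk, he⟩ := Finset.mem_filter.1 hS
        obtain ⟨hxS, hyS, -⟩ := mk_mem_cliqueEdges.1 he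
        refine Finset.mem_Icc.2 ⟨?_, hk ▸ Finset.card_le_card Finset.inter_subset_left⟩
        rw [← Finset.card_pair hxy]
        refine Finset.card_le_card ?_
        intro z hz
        rcases Finset.mem_insert.1 hz with rfl | hz
        · exact Finset.mem_inter.2 ⟨hxS, hx⟩
        · rw [Finset.mem_singleton.1 hz]
          exact Finset.mem_inter.2 ⟨hyS, hy⟩
    _ ≤ _ := by
        refine mul_le_mul_of_nonneg_left (Finset.sum_le_sum fun j _ => ?_) (by positivity)
        rw [Finset.sum_congr rfl (g := fun _ => p ^ (k.choose 2 - j.choose 2 - 1))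
          (fun S hS => by rw [(Finset.mem_filter.1 hS).2]), Finset.sum_const, nsmul_eq_mul]
        refine mul_le_mul_of_nonneg_right ?_ (by positivity)
        have := card_sets_inter_le (k := k) (j := j) hxy hx hy hw
        rw [h𝒮, Finset.filter_filter]
        exact_mod_cast this

lemma danger_empty_le (X : Finset (Sym2 V)) (hX : ∀ e ∈ X, ¬ e.IsDiag) (k t q : ℕ) (lam : ℝ)
    (hlam : k.choose 2 * ∑ j ∈ Finset.Icc 2 k,
        ((2 + k * t : ℕ) : ℝ) ^ (j - 2) * (Fintype.card V : ℝ) ^ (k - j) *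
          ((1 + q : ℝ)⁻¹) ^ (k.choose 2 - j.choose 2 - 1) ≤ lam) :
    danger (pieceTuples X k t) pieceUnion q ∅ ∅ ≤ X.card * lam ^ t := by
  have hlam0 : 0 ≤ lam := le_trans (by positivity) hlam
  simp only [danger, Finset.disjoint_empty_right, Finset.filter_true, Finset.sdiff_empty]
  rw [pieceTuples, Finset.sum_sigma, ← nsmul_eq_mul]
  refine Finset.sum_le_card_nsmul _ _ _ fun e he => ?_
  have := sum_pow_card_biUnion_le (pieces k e) (piece e) ((1 + q : ℝ)⁻¹) lam hlam0 (by positivity)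
    (fun r U => ∃ W : Finset V, e ∈ cliqueEdges W ∧ U ⊆ cliqueEdges W ∧ W.card + k * r ≤ 2 + k * t)
    ?_ ?_ t ∅ ?_
  · simpa [pieceUnion] using this
  · rintro r U ⟨W, heW, hU, hW⟩ a ha
    obtain ⟨-, hk, -, -, -⟩ := Finset.mem_filter.1 ha
    refine ⟨W ∪ a.1, cliqueEdges_mono Finset.subset_union_left heW, Finset.union_subset
      (hU.trans (cliqueEdges_mono Finset.subset_union_left)) ?_, ?_⟩
    · refine ((Finset.erase_subset _ _).trans (Finset.erase_subset _ _)).trans ?_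
      exact cliqueEdges_mono Finset.subset_union_right
    · have := Finset.card_union_le W a.1
      rw [mul_add] at hW
      omega
  · rintro r U ⟨W, heW, hU, hW⟩
    refine (sum_pieces_le (by positivity) ?_ heW hU (w := 2 + k * t) (by omega)).trans hlam
    exact inv_le_one_of_one_le₀ (by linarith [(Nat.cast_nonneg q : (0 : ℝ) ≤ q)])
  · induction e with
    | _ x y =>
    have hxy : x ≠ y := fun h => hX _ he (by simp [h])
    refine ⟨{x, y}, mk_mem_cliqueEdges.2 (by simp [hxy]), by simp, ?_⟩
    rw [Finset.card_pair hxy]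

end BreakerMoment

section BreakerAsymptotics

lemma two_mul_choose_two (n : ℕ) : 2 * n.choose 2 = n * (n - 1) := by
  rw [Nat.choose_two_right, Nat.mul_div_cancel' (Nat.even_mul_pred_self n).two_dvd]

lemma two_mul_choose_sub {j k : ℕ} (hj : 2 ≤ j) (hjk : j ≤ k) :
    2 * (k.choose 2 - j.choose 2) = (k - j) * (k + 1) + (k - j) * (j - 2) := by
  rw [Nat.mul_sub, two_mul_choose_two, two_mul_choose_two]
  obtain ⟨i, rfl⟩ := Nat.exists_eq_add_of_le hj
  obtain ⟨d, rfl⟩ := Nat.exists_eq_add_of_le hjk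
  have h1 : 2 + i + d - 1 = 1 + i + d := by omega
  have h2 : 2 + i - 1 = 1 + i := by omega
  have h3 : 2 + i + d - (2 + i) = d := by omega
  have h4 : 2 + i - 2 = i := by omega
  rw [h1, h2, h3, h4]
  apply Nat.sub_eq_of_eq_add
  ring

lemma choose_two_lt {j k : ℕ} (hj : 2 ≤ j) (hjk : j < k) : j.choose 2 < k.choose 2 := by
  have h := two_mul_choose_sub hj hjk.le
  have : 0 < (k - j) * (k + 1) := Nat.mul_pos (by omega) (by omega)
  omega

/-- With `n = y ^ (k + 1)` and edge density `p ≤ 1 / (D y²)`, a `j`-set is expected to have at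
most `D⁻¹ y ^ (-(k - j) (j - 2))` extensions to a `k`-clique. -/
lemma pow_mul_pow_le {j k : ℕ} (hj : 2 ≤ j) (hjk : j < k) {y D p : ℝ} (hy : 1 ≤ y) (hD : 1 ≤ D)
    (hp0 : 0 ≤ p) (hp : p ≤ (D * y ^ 2)⁻¹) :
    (y ^ (k + 1)) ^ (k - j) * p ^ (k.choose 2 - j.choose 2) ≤
      D⁻¹ * (y ^ ((k - j) * (j - 2)))⁻¹ := by
  have hE := two_mul_choose_sub hj hjk.le
  have hlt := choose_two_lt hj hjk
  set E := k.choose 2 - j.choose 2 with hEdef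
  have hy0 : 0 < y := by linarith
  have hD0 : 0 < D := by linarith
  calc (y ^ (k + 1)) ^ (k - j) * p ^ E
      ≤ (y ^ (k + 1)) ^ (k - j) * ((D * y ^ 2)⁻¹) ^ E := by gcongr
    _ = (D ^ E)⁻¹ * (y ^ ((k - j) * (j - 2)))⁻¹ := by
        rw [inv_pow, mul_pow, ← pow_mul, ← pow_mul, hE, pow_add, mul_comm (k + 1) (k - j)]
        field_simp
    _ ≤ D⁻¹ * (y ^ ((k - j) * (j - 2)))⁻¹ := by
        gcongr
        exact le_self_pow₀ hD (by omega)

lemma sum_extension_le {k w q : ℕ} (hk : 3 ≤ k) (hw : 1 ≤ w) {n y D : ℝ} (hy : 1 ≤ y)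
    (hn : n = y ^ (k + 1)) (hD : 1 ≤ D) (hq : D * y ^ 2 ≤ q) :
    ∑ j ∈ Finset.Icc 2 k, (w : ℝ) ^ (j - 2) * n ^ (k - j) *
      ((1 + q : ℝ)⁻¹) ^ (k.choose 2 - j.choose 2 - 1) ≤ (1 + q) * (D⁻¹ + k * (w ^ k / y)) := by
  have hy0 : 0 < y := by linarith
  have hD0 : 0 < D := by linarith
  have hw1 : (1 : ℝ) ≤ w := by exact_mod_cast hw
  have hq1 : (0 : ℝ) < 1 + q := by positivity
  have hyq : y ≤ 1 + q := by nlinarith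
  have hp : (1 + q : ℝ)⁻¹ ≤ (D * y ^ 2)⁻¹ := inv_anti₀ (by positivity) (by linarith)
  have hterm : ∀ j ∈ Finset.Icc 2 k, (w : ℝ) ^ (j - 2) * n ^ (k - j) *
      ((1 + q : ℝ)⁻¹) ^ (k.choose 2 - j.choose 2 - 1) ≤
      (1 + q) * ((if j = 2 then D⁻¹ else 0) + w ^ k / y) := by
    intro j hj
    obtain ⟨hj2, hjk⟩ := Finset.mem_Icc.1 hj
    have hwk : (w : ℝ) ^ (j - 2) ≤ w ^ k := pow_le_pow_right₀ hw1 (by omega)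
    rcases hjk.eq_or_lt with rfl | hjk
    · rw [if_neg (by omega)]
      simp only [Nat.sub_self, pow_zero, mul_one, zero_add, Nat.zero_sub]
      rw [mul_div_assoc', le_div_iff₀ hy0, mul_comm]
      gcongr
    · have hlt := choose_two_lt hj2 hjk
      have h1 := pow_mul_pow_le hj2 hjk hy hD (by positivity) hp
      have h2 : ((1 + q : ℝ)⁻¹) ^ (k.choose 2 - j.choose 2 - 1) =
          (1 + q) * ((1 + q : ℝ)⁻¹) ^ (k.choose 2 - j.choose 2) := by
        obtain ⟨m, hm⟩ : ∃ m, k.choose 2 - j.choose 2 = m + 1 :=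
          ⟨k.choose 2 - j.choose 2 - 1, by omega⟩
        rw [hm, Nat.add_sub_cancel, pow_succ]
        field_simp
      rw [h2, hn]
      calc (w : ℝ) ^ (j - 2) * (y ^ (k + 1)) ^ (k - j) *
            ((1 + q) * ((1 + q : ℝ)⁻¹) ^ (k.choose 2 - j.choose 2))
          = (1 + q) * ((w : ℝ) ^ (j - 2) * ((y ^ (k + 1)) ^ (k - j) *
            ((1 + q : ℝ)⁻¹) ^ (k.choose 2 - j.choose 2))) := by ring
        _ ≤ (1 + q) * ((w : ℝ) ^ (j - 2) * (D⁻¹ * (y ^ ((k - j) * (j - 2)))⁻¹)) := by gcongr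
        _ ≤ (1 + q) * ((if j = 2 then D⁻¹ else 0) + w ^ k / y) := by
            gcongr
            split_ifs with h
            · subst h
              simp only [Nat.sub_self, pow_zero, mul_zero, inv_one, mul_one, one_mul]
              have : (0 : ℝ) ≤ w ^ k / y := by positivity
              linarith
            · rw [zero_add, div_eq_mul_inv]
              have h3 : D⁻¹ ≤ 1 := inv_le_one_of_one_le₀ hD
              have h4 : (y ^ ((k - j) * (j - 2)))⁻¹ ≤ y⁻¹ := by
                refine inv_anti₀ hy0 (le_self_pow₀ hy ?_)
                exact Nat.mul_ne_zero (by omega) (by omega)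
              have h5 : D⁻¹ * (y ^ ((k - j) * (j - 2)))⁻¹ ≤ 1 * y⁻¹ := by gcongr
              rw [one_mul] at h5
              gcongr
  refine (Finset.sum_le_sum hterm).trans ?_
  rw [← Finset.mul_sum, Finset.sum_add_distrib, Finset.sum_ite_eq', if_pos (by simp; omega),
    Finset.sum_const, Nat.card_Icc, nsmul_eq_mul]
  gcongr
  omega

open Filter Topology in
lemma exists_polylog_le (k : ℕ) (hk : 1 ≤ k) (A : ℝ) (hA : 1 ≤ A) : ∃ n₀ : ℕ, ∀ n : ℕ, n₀ ≤ n →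
    A * ((2 + k * (4 * (Nat.log 2 n + 1)) : ℕ) : ℝ) ^ k ≤ (n : ℝ) ^ (1 / (k + 1 : ℝ)) := by
  set r : ℝ := 1 / ((k + 1) * k) with hr
  have hk0 : (0 : ℝ) < k := by exact_mod_cast hk
  have hr0 : 0 < r := by positivity
  have h1 : Tendsto (fun x : ℝ => (2 + 4 * k) / x ^ r + 4 * k / Real.log 2 * (Real.log x / x ^ r))
      atTop (𝓝 (0 + 4 * k / Real.log 2 * 0)) := by
    refine Tendsto.add ?_ (Tendsto.const_mul _ ?_)
    · exact Tendsto.div_atTop tendsto_const_nhds (tendsto_rpow_atTop hr0)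
    · exact (isLittleO_log_rpow_atTop hr0).tendsto_div_nhds_zero
  rw [mul_zero, add_zero] at h1
  have h2 := (h1.comp tendsto_natCast_atTop_atTop).eventually_lt_const (by positivity : 0 < A⁻¹)
  obtain ⟨n₀, hn₀⟩ := eventually_atTop.1 (h2.and (eventually_ge_atTop 1))
  refine ⟨n₀, fun n hn => ?_⟩
  obtain ⟨h3, h4⟩ := hn₀ n hn
  have hn0 : (0 : ℝ) < n := by exact_mod_cast h4
  have hx : (0 : ℝ) < (n : ℝ) ^ r := by positivity
  simp only [Function.comp_apply] at h3
  have h5 : ((2 + k * (4 * (Nat.log 2 n + 1)) : ℕ) : ℝ) ≤ A⁻¹ * (n : ℝ) ^ r := by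
    have h6 : (Nat.log 2 n : ℝ) ≤ Real.log n / Real.log 2 := by
      have := Real.natLog_le_logb n 2
      simpa [Real.logb] using this
    calc ((2 + k * (4 * (Nat.log 2 n + 1)) : ℕ) : ℝ)
        = 2 + 4 * k + 4 * k * (Nat.log 2 n : ℝ) := by push_cast; ring
      _ ≤ 2 + 4 * k + 4 * k * (Real.log n / Real.log 2) := by gcongr
      _ = ((2 + 4 * k) / (n : ℝ) ^ r + 4 * k / Real.log 2 * (Real.log n / (n : ℝ) ^ r)) *
            (n : ℝ) ^ r := by field_simp
      _ ≤ A⁻¹ * (n : ℝ) ^ r := by gcongr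
  calc A * ((2 + k * (4 * (Nat.log 2 n + 1)) : ℕ) : ℝ) ^ k ≤ A * (A⁻¹ * (n : ℝ) ^ r) ^ k := by
        gcongr
    _ = (A * A⁻¹ ^ k) * (n : ℝ) ^ (1 / (k + 1 : ℝ)) := by
        rw [mul_pow, ← Real.rpow_mul_natCast hn0.le, hr]
        have : 1 / ((k + 1 : ℝ) * k) * k = 1 / (k + 1) := by field_simp
        rw [this]; ring
    _ ≤ 1 * (n : ℝ) ^ (1 / (k + 1 : ℝ)) := by
        gcongr
        calc A * A⁻¹ ^ k ≤ A * A⁻¹ ^ 1 := by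
              refine mul_le_mul_of_nonneg_left ?_ (by positivity)
              exact pow_le_pow_of_le_one (by positivity) (inv_le_one_of_one_le₀ hA) hk
          _ = 1 := by rw [pow_one]; field_simp
    _ = _ := one_mul _

lemma exists_clique_of_hasTCopy {k : ℕ} {T : Fin k → Fin k → Prop} (hT : IsTournament T)
    {M : Finset (V × V)} (hM : HasTCopy T M) :
    ∃ S : Finset V, S.card = k ∧ cliqueEdges S ⊆ undirect M := by
  obtain ⟨f, hf, hfM⟩ := hM
  refine ⟨Finset.univ.image f, by rw [Finset.card_image_of_injective _ hf]; simp, fun e => ?_⟩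
  induction e with
  | _ x y =>
  rw [mk_mem_cliqueEdges]
  rintro ⟨hx, hy, hxy⟩
  obtain ⟨i, -, rfl⟩ := Finset.mem_image.1 hx
  obtain ⟨j, -, rfl⟩ := Finset.mem_image.1 hy
  have hij : i ≠ j := fun h => hxy (by rw [h])
  by_cases h : T i j
  · exact Finset.mem_image.2 ⟨_, hfM i j h, rfl⟩
  · exact Finset.mem_image.2 ⟨_, hfM j i ((hT.2 j i hij.symm).2 h), Sym2.eq_swap⟩

lemma rpow_two_div (k n : ℕ) :
    (n : ℝ) ^ (2 / (k + 1 : ℝ)) = ((n : ℝ) ^ (1 / (k + 1 : ℝ))) ^ 2 := by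
  rw [← Real.rpow_mul_natCast (Nat.cast_nonneg n)]
  congr 1
  push_cast
  ring

lemma rpow_one_div_pow (k n : ℕ) : (n : ℝ) = ((n : ℝ) ^ (1 / (k + 1 : ℝ))) ^ (k + 1) := by
  rw [← Real.rpow_mul_natCast (Nat.cast_nonneg n)]
  have : 1 / (k + 1 : ℝ) * ((k + 1 : ℕ) : ℝ) = 1 := by push_cast; field_simp
  rw [this, Real.rpow_one]

theorem breaker_wins (k : ℕ) (hk : 3 ≤ k) (T : Fin k → Fin k → Prop) (hT : IsTournament T) :
    ∃ C : ℝ, 0 < C ∧ ∃ n₀ : ℕ, ∀ n : ℕ, n₀ ≤ n → ∀ b : ℕ,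
      C * (n : ℝ) ^ (2 / (k + 1 : ℝ)) ≤ (b : ℝ) →
        OBreakerBlock (completeEdges n) (HasTCopy T) b ∅ ∅ := by
  set l : ℝ := (k.choose 2 : ℝ) with hl
  have hl1 : 1 ≤ l := by
    have : 1 ≤ k.choose 2 := Nat.choose_pos (by omega)
    rw [hl]; exact_mod_cast this
  have hk1 : (1 : ℝ) ≤ k := by exact_mod_cast (by omega : 1 ≤ k)
  obtain ⟨n₁, hn₁⟩ := exists_polylog_le k (by omega) (4 * l * k) (by nlinarith)
  refine ⟨16 * l, by positivity, max n₁ (⌈4 * l + 2⌉₊), fun n hn b hb => ?_⟩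
  have hn1 := hn₁ n (le_of_max_le_left hn)
  have hn2 : 4 * l + 2 ≤ n := Nat.ceil_le.1 (le_of_max_le_right hn)
  have hny := rpow_one_div_pow k n
  rw [rpow_two_div] at hb
  set y : ℝ := (n : ℝ) ^ (1 / (k + 1 : ℝ)) with hy
  have hy1 : 1 ≤ y := Real.one_le_rpow (by linarith) (by positivity)
  set q : ℕ := ⌈4 * l * y ^ 2⌉₊ with hq
  have hq1 : 4 * l * y ^ 2 ≤ q := Nat.le_ceil _
  have hq2 : (q : ℝ) < 4 * l * y ^ 2 + 1 := Nat.ceil_lt_add_one (by positivity)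
  have hly : 1 ≤ l * y ^ 2 := by nlinarith
  set t := 4 * (Nat.log 2 n + 1) with ht
  refine breaker_clique (completeEdges n) (HasTCopy T) k t q b hk
    (fun M hM => exists_clique_of_hasTCopy hT hM) ?_ ?_
  · have : (2 * q : ℝ) ≤ b := by linarith
    exact_mod_cast this
  have hlam := sum_extension_le (k := k) (w := 2 + k * t) (q := q) (D := 4 * l) hk (by omega) hy1
    hny (by linarith) hq1
  have hdanger := danger_empty_le (completeEdges n)
    (fun e he => (Finset.mem_filter.1 he).2) k t q ((1 + q) / 2) (by
      rw [Fintype.card_fin]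
      refine (mul_le_mul_of_nonneg_left hlam (by positivity)).trans ?_
      have h1 : l * k * (((2 + k * t : ℕ) : ℝ) ^ k / y) ≤ 1 / 4 := by
        rw [mul_div_assoc', div_le_iff₀ (by linarith)]
        linarith
      have h2 : l * (4 * l)⁻¹ = 1 / 4 := by field_simp
      calc l * ((1 + q : ℝ) * ((4 * l)⁻¹ + k * (((2 + k * t : ℕ) : ℝ) ^ k / y)))
          = (1 + q) * (l * (4 * l)⁻¹ + l * k * (((2 + k * t : ℕ) : ℝ) ^ k / y)) := by ring
        _ ≤ (1 + q) * (1 / 4 + 1 / 4) := by rw [h2]; gcongr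
        _ = _ := by ring)
  have hX : ((completeEdges n).card : ℝ) ≤ n ^ 2 := by
    have h1 : (completeEdges n).card ≤ (n + 1).choose 2 := by
      have := Finset.card_le_univ (completeEdges n)
      rwa [Sym2.card, Fintype.card_fin] at this
    have h2 := two_mul_choose_two (n + 1)
    have h3 : (completeEdges n).card ≤ n ^ 2 := by
      rw [Nat.add_sub_cancel] at h2
      have h4 : 1 ≤ n := by
        have : (1 : ℝ) ≤ n := by linarith
        exact_mod_cast this
      nlinarith
    exact_mod_cast h3
  have hyn : y ^ 2 ≤ n := by
    rw [hny]; exact pow_le_pow_right₀ hy1 (by omega)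
  have hqn : (1 + q : ℝ) ≤ n ^ 2 := by nlinarith
  have hnt : (n : ℝ) ^ 4 < 2 ^ t := by
    have h1 : n < 2 ^ (Nat.log 2 n + 1) := Nat.lt_pow_succ_log_self (by norm_num) n
    rw [ht, mul_comm, pow_mul]
    have h2 : (n : ℝ) < 2 ^ (Nat.log 2 n + 1) := by exact_mod_cast h1
    gcongr
  calc (1 + q : ℝ) * danger (pieceTuples (completeEdges n) k t) pieceUnion q ∅ ∅
      ≤ n ^ 2 * (n ^ 2 * ((1 + q) / 2) ^ t) := by
        refine mul_le_mul hqn (hdanger.trans ?_) ?_ (by positivity)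
        · gcongr
        · exact Finset.sum_nonneg fun _ _ => by positivity
    _ = n ^ 4 * ((1 + q) / 2) ^ t := by ring
    _ < 2 ^ t * ((1 + q) / 2) ^ t := by gcongr
    _ = (1 + q) ^ t := by rw [← mul_pow]; congr 1; ring

end BreakerAsymptotics

section MakerGame

lemma not_makerWin_step {X : Finset (Sym2 V)} {F : Finset (Sym2 V) → Prop} {b : ℕ}
    {M B : Finset (Sym2 V)} (h : ¬ MakerWin X F b M B) {e : Sym2 V} (heX : e ∈ X)
    (he : e ∉ M ∪ B) : ∃ B' : Finset (Sym2 V), B'.card ≤ b ∧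
      ¬ MakerWin X F b (insert e M) (B ∪ B') := by
  by_contra hcon
  push Not at hcon
  exact h (.move M B e heX he fun B' _ hB' => hcon B' (hB' ▸ min_le_left _ _))

/-- If Maker does not win, then in `r` rounds in which she tries to claim the edges
`g i (e i)`, for uniformly random `e`, Breaker blocks on average at most `r * K / card Ω` of the
attempts, where `K` bounds the number of edges of Breaker. The set `I e` collects the blocked
attempts. -/
lemma exists_failure_sets {X : Finset (Sym2 V)} {F : Finset (Sym2 V) → Prop} {b : ℕ}
    {Ω : Type*} [Fintype Ω] (K : ℕ) (r : ℕ) :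
    ∀ (g : Fin r → Ω → Sym2 V), (∀ i, Function.Injective (g i)) → (∀ i ω, g i ω ∈ X) →
    ∀ M B : Finset (Sym2 V), ¬ MakerWin X F b M B →
      M.card + B.card + r * (b + 1) ≤ Fintype.card Ω → B.card + r * b ≤ K →
    ∃ I : (Fin r → Ω) → Finset (Fin r),
      (∀ e, ∃ M', ¬ F M' ∧ M ⊆ M' ∧ ∀ i, i ∉ I e → g i (e i) ∈ M') ∧
      (∑ e, (I e).card) * Fintype.card Ω ≤ r * K * Fintype.card Ω ^ r := by
  classical
  induction r with
  | zero =>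
    intro g _ _ M B hM _ _
    exact ⟨fun _ => ∅, fun e => ⟨M, fun h => hM (.win M B h), le_rfl, fun i => i.elim0⟩, by simp⟩
  | succ r ih =>
    intro g hg hgX M B hM hN hK
    set N := Fintype.card Ω with hNdef
    have hcardMB : (M ∪ B).card < N := by
      have := Finset.card_union_le M B
      rw [Nat.succ_mul] at hN
      omega
    have hstep : ∀ ω : Ω, ∃ e ∈ X, e ∉ M ∪ B ∧ (g 0 ω ∉ M ∪ B → e = g 0 ω) := by
      intro ω
      by_cases h : g 0 ω ∈ M ∪ B
      · obtain ⟨ω', hω'⟩ : ∃ ω', g 0 ω' ∉ M ∪ B := by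
          by_contra hcon
          push Not at hcon
          have := Finset.card_le_card_of_injOn (s := Finset.univ) (g 0) (fun ω _ => hcon ω)
            ((hg 0).injOn)
          rw [Finset.card_univ] at this
          omega
        exact ⟨_, hgX 0 ω', hω', fun h' => absurd h h'⟩
      · exact ⟨_, hgX 0 ω, h, fun _ => rfl⟩
    choose c hcX hcfree hceq using hstep
    have hreply := fun ω => not_makerWin_step hM (hcX ω) (hcfree ω)
    choose R hRb hRM using hreply
    have hih := fun ω => ih (fun i => g i.succ) (fun i => hg _) (fun i => hgX _) _ _ (hRM ω)
      (by
        have h1 := Finset.card_union_le B (R ω)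
        have h2 := Finset.card_insert_le (c ω) M
        have h3 := hRb ω
        rw [Nat.succ_mul] at hN
        omega)
      (by
        have h1 := Finset.card_union_le B (R ω)
        have h3 := hRb ω
        rw [Nat.succ_mul] at hK
        omega)
    choose J hJ hJsum using hih
    refine ⟨fun e => (if g 0 (e 0) ∈ B then {0} else ∅) ∪
      (J (e 0) (fun i => e i.succ)).map (Fin.succEmb r), fun e => ?_, ?_⟩
    · obtain ⟨M', hFM', hsub, hmem⟩ := hJ (e 0) (fun i => e i.succ)
      refine ⟨M', hFM', (Finset.subset_insert _ _).trans hsub, fun i => ?_⟩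
      refine Fin.cases (fun h0 => ?_) (fun i hi => ?_) i
      · have hB : g 0 (e 0) ∉ B := fun h => h0 (by simp [h])
        by_cases hgM : g 0 (e 0) ∈ M
        · exact hsub (Finset.mem_insert_of_mem hgM)
        · rw [← hceq (e 0) (by simp [hB, hgM])]
          exact hsub (Finset.mem_insert_self _ _)
      · refine hmem i fun h => hi ?_
        exact Finset.mem_union_right _ (Finset.mem_map.2 ⟨i, h, rfl⟩)
    · have hblocked : (Finset.univ.filter fun ω => g 0 ω ∈ B).card ≤ K := by
        refine (Finset.card_le_card_of_injOn (t := B) (g 0) (fun ω h => ?_)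
          ((hg 0).injOn)).trans (by omega)
        exact (Finset.mem_filter.1 (Finset.mem_coe.1 h)).2
      have h1 : ∑ e : Fin (r + 1) → Ω, ((if g 0 (e 0) ∈ B then {0} else ∅) ∪
          (J (e 0) (fun i => e i.succ)).map (Fin.succEmb r)).card ≤
          ∑ ω : Ω, ∑ e' : Fin r → Ω, ((if g 0 ω ∈ B then 1 else 0) + (J ω e').card) := by
        rw [← Fintype.sum_prod_type', ← (Fin.consEquiv fun _ => Ω).sum_comp]
        refine Finset.sum_le_sum fun x _ => (Finset.card_union_le _ _).trans ?_
        rw [Finset.card_map]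
        simp only [Fin.consEquiv_apply, Fin.cons_zero, Fin.cons_succ]
        split_ifs <;> simp
      have h2 : ∑ ω : Ω, ∑ e' : Fin r → Ω, ((if g 0 ω ∈ B then 1 else 0) + (J ω e').card) =
          (Finset.univ.filter fun ω => g 0 ω ∈ B).card * N ^ r +
            ∑ ω : Ω, ∑ e' : Fin r → Ω, (J ω e').card := by
        simp only [Finset.sum_add_distrib, Finset.sum_const, Finset.card_univ, smul_eq_mul,
          Fintype.card_fun, Fintype.card_fin]
        rw [← Finset.mul_sum, Finset.sum_boole, mul_comm]
        simp [← hNdef]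
      calc _ ≤ ((Finset.univ.filter fun ω => g 0 ω ∈ B).card * N ^ r +
            ∑ ω : Ω, ∑ e' : Fin r → Ω, (J ω e').card) * N :=
            Nat.mul_le_mul_right _ (h1.trans h2.le)
        _ = (Finset.univ.filter fun ω => g 0 ω ∈ B).card * N ^ (r + 1) +
            ∑ ω : Ω, (∑ e' : Fin r → Ω, (J ω e').card) * N := by
            rw [add_mul, Finset.sum_mul]; ring
        _ ≤ K * N ^ (r + 1) + ∑ _ω : Ω, r * K * N ^ r := by
            refine Nat.add_le_add (Nat.mul_le_mul_right _ hblocked) ?_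
            exact Finset.sum_le_sum fun ω _ => hJsum ω
        _ = (r + 1) * K * N ^ (r + 1) := by
            rw [Finset.sum_const, Finset.card_univ, smul_eq_mul, ← hNdef]; ring

/-- Version of `exists_failure_sets` for the starting position and arbitrary index types. -/
lemma exists_failure_sets_of_fintype {X : Finset (Sym2 V)} {F : Finset (Sym2 V) → Prop} {b : ℕ}
    {ι Ω : Type*} [Fintype ι] [DecidableEq ι] [Fintype Ω] (g : ι → Ω → Sym2 V)
    (hg : ∀ i, Function.Injective (g i)) (hgX : ∀ i ω, g i ω ∈ X)
    (hM : ¬ MakerWin X F b ∅ ∅) (hN : Fintype.card ι * (b + 1) ≤ Fintype.card Ω) :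
    ∃ I : (ι → Ω) → Finset ι,
      (∀ e, ∃ M', ¬ F M' ∧ ∀ i, i ∉ I e → g i (e i) ∈ M') ∧
      (∑ e, (I e).card) * Fintype.card Ω ≤
        Fintype.card ι * (Fintype.card ι * b) * Fintype.card Ω ^ Fintype.card ι := by
  set σ := Fintype.equivFin ι
  obtain ⟨I, hI, hsum⟩ := exists_failure_sets (X := X) (F := F) (b := b) (Fintype.card ι * b)
    (Fintype.card ι) (fun i => g (σ.symm i)) (fun i => hg _) (fun i => hgX _) ∅ ∅ hM (by simpa)
    (by simp)
  refine ⟨fun e => (I fun i => e (σ.symm i)).map σ.symm.toEmbedding, fun e => ?_, ?_⟩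
  · obtain ⟨M', hM', -, h⟩ := hI fun i => e (σ.symm i)
    refine ⟨M', hM', fun i hi => ?_⟩
    have := h (σ i) fun h => hi (Finset.mem_map.2 ⟨σ i, h, by simp⟩)
    simpa using this
  · refine le_trans (le_of_eq ?_) hsum
    congr 1
    simp only [Finset.card_map]
    exact (σ.arrowCongr (Equiv.refl Ω)).sum_comp (fun e => (I e).card)

/-- Orienting her edges by a fixed rule, Maker transfers a strategy to the oriented game. -/
lemma MakerWin.oriented {X : Finset (Sym2 V)} {F : Finset (Sym2 V) → Prop}
    {F' : Finset (V × V) → Prop} {b : ℕ} (o : Sym2 V → V × V) (ho : ∀ e, s((o e).1, (o e).2) = e)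
    (hF : ∀ M, F M → F' (M.image o)) {M B : Finset (Sym2 V)} (h : MakerWin X F b M B) :
    OMakerWin X F' b (M.image o) B := by
  have hu : ∀ M : Finset (Sym2 V), undirect (M.image o) = M := fun M => by
    simp [undirect, Finset.image_image, Function.comp_def, ho]
  induction h with
  | win M B hM => exact .win _ _ (hF M hM)
  | move M B e heX hfree _ ih =>
    refine .move _ _ (o e).1 (o e).2 (by rwa [ho]) (by rwa [ho, hu]) fun B' hB' hc => ?_
    rw [ho, hu] at hB' hc
    have := ih B' hB' hc
    rwa [Finset.image_insert] at this

end MakerGame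

section FirstMoment

lemma card_filter_agree {ι Ω : Type*} [Fintype ι] [DecidableEq ι] [Fintype Ω] [DecidableEq Ω]
    (D : Finset ι) (h : ι → Ω) :
    (Finset.univ.filter fun e : ι → Ω => ∀ i ∈ D, e i = h i).card =
      Fintype.card Ω ^ (Fintype.card ι - D.card) := by
  have h1 : (Finset.univ.filter fun e : ι → Ω => ∀ i ∈ D, e i = h i) =
      Fintype.piFinset fun i => if i ∈ D then {h i} else Finset.univ := by
    ext e
    simp only [Finset.mem_filter, Finset.mem_univ, true_and, Fintype.mem_piFinset]
    refine forall_congr' fun i => ?_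
    split_ifs with hi <;> simp [hi]
  rw [h1, Fintype.card_piFinset, ← Finset.card_compl, ← Finset.prod_const]
  rw [← Finset.prod_filter_mul_prod_filter_not Finset.univ (· ∈ D),
    Finset.prod_eq_one (fun i hi => by simp [(Finset.mem_filter.1 hi).2]), one_mul]
  refine Finset.prod_congr (by ext; simp) fun i hi => ?_
  simp [Finset.mem_compl.1 hi]

/-- If all members of a family meet `I`, then up to pairs of intersecting members the family has
at most `#I` members. -/
lemma card_le_card_pairs_add {ι α : Type*} [DecidableEq ι] [DecidableEq α] (Q : Finset α)
    (D : α → Finset ι) (I : Finset ι) (hI : ∀ a ∈ Q, (D a ∩ I).Nonempty) :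
    Q.card ≤ (Q.offDiag.filter fun x => (D x.1 ∩ D x.2).Nonempty).card + I.card := by
  rcases Q.eq_empty_or_nonempty with rfl | ⟨a₀, ha₀⟩
  · simp
  have : Nonempty α := ⟨a₀⟩
  have : Nonempty ι := ⟨(hI a₀ ha₀).choose⟩
  choose! φ hφ using hI
  set rep := Function.invFunOn φ Q with hrep
  have hrepQ : ∀ a ∈ Q, rep (φ a) ∈ Q := fun a ha => Function.invFunOn_mem ⟨a, ha, rfl⟩
  have hrepφ : ∀ a ∈ Q, φ (rep (φ a)) = φ a := fun a ha => Function.invFunOn_eq ⟨a, ha, rfl⟩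
  rw [← Finset.card_filter_add_card_filter_not (s := Q) fun a => a ≠ rep (φ a)]
  refine Nat.add_le_add ?_ ?_
  · refine Finset.card_le_card_of_injOn (fun a => (a, rep (φ a))) (fun a ha => ?_)
      fun a _ b _ hab => (Prod.mk.inj hab).1
    obtain ⟨haQ, hne⟩ := Finset.mem_filter.1 (Finset.mem_coe.1 ha)
    refine Finset.mem_coe.2 (Finset.mem_filter.2
      ⟨Finset.mem_offDiag.2 ⟨haQ, hrepQ a haQ, hne⟩, φ a, ?_⟩)
    have h1 := Finset.mem_inter.1 (hφ a haQ)
    have h2 := Finset.mem_inter.1 (hφ _ (hrepQ a haQ))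
    rw [hrepφ a haQ] at h2
    exact Finset.mem_inter.2 ⟨h1.1, h2.1⟩
  · refine Finset.card_le_card_of_injOn φ (fun a ha => ?_) fun a ha b hb hab => ?_
    · exact (Finset.mem_inter.1 (hφ a (Finset.mem_filter.1 (Finset.mem_coe.1 ha)).1)).2
    · have h1 := (Finset.mem_filter.1 (Finset.mem_coe.1 ha)).2
      have h2 := (Finset.mem_filter.1 (Finset.mem_coe.1 hb)).2
      rw [not_not] at h1 h2
      rw [h1, h2, hab]

/-- First moment inequality for families prescribing the values `h a i`, `i ∈ D a`, of a uniformly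
random `e : ι → Ω`, when every prescription satisfied by `e` meets `I e`. -/
lemma sum_inv_pow_le {ι Ω α : Type*} [Fintype ι] [DecidableEq ι] [Fintype Ω] [DecidableEq Ω]
    [Nonempty Ω] [Fintype α] [DecidableEq α] (D : α → Finset ι) (h : α → ι → Ω)
    (I : (ι → Ω) → Finset ι)
    (hI : ∀ e a, (∀ i ∈ D a, e i = h a i) → (D a ∩ I e).Nonempty) :
    ∑ a, ((Fintype.card Ω : ℝ)⁻¹) ^ (D a).card ≤
      (∑ x : α × α with x.1 ≠ x.2 ∧ (D x.1 ∩ D x.2).Nonempty ∧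
          ∀ i ∈ D x.1 ∩ D x.2, h x.1 i = h x.2 i,
        ((Fintype.card Ω : ℝ)⁻¹) ^ (D x.1 ∪ D x.2).card) +
      (∑ e, (I e).card : ℕ) / (Fintype.card Ω : ℝ) ^ Fintype.card ι := by
  set N := Fintype.card Ω with hN
  have hN0 : (0 : ℝ) < N := by exact_mod_cast Fintype.card_pos
  set P : Finset (α × α) := Finset.univ.filter fun x => x.1 ≠ x.2 ∧ (D x.1 ∩ D x.2).Nonempty ∧
    ∀ i ∈ D x.1 ∩ D x.2, h x.1 i = h x.2 i with hP
  have hpow : ∀ E : Finset ι, ((N : ℝ)⁻¹) ^ E.card =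
      (N ^ (Fintype.card ι - E.card) : ℕ) / (N : ℝ) ^ Fintype.card ι := fun E => by
    rw [eq_div_iff (by positivity), Nat.cast_pow, inv_pow, inv_mul_eq_iff_eq_mul₀ (by positivity),
      ← pow_add, Nat.add_sub_cancel' (Finset.card_le_univ E)]
  have key : ∑ a, N ^ (Fintype.card ι - (D a).card) ≤
      ∑ x ∈ P, N ^ (Fintype.card ι - (D x.1 ∪ D x.2).card) + ∑ e, (I e).card := by
    have h1 : ∀ a, N ^ (Fintype.card ι - (D a).card) =
        ∑ e : ι → Ω, if (∀ i ∈ D a, e i = h a i) then 1 else 0 := fun a => by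
      rw [← card_filter_agree (D a) (h a), Finset.card_filter]
    have h2 : ∀ x ∈ P, ∑ e : ι → Ω, (if (∀ i ∈ D x.1, e i = h x.1 i) ∧
        (∀ i ∈ D x.2, e i = h x.2 i) then 1 else 0) ≤
        N ^ (Fintype.card ι - (D x.1 ∪ D x.2).card) := fun x _ => by
      rw [← card_filter_agree (D x.1 ∪ D x.2) fun i => if i ∈ D x.1 then h x.1 i else h x.2 i,
        ← Finset.card_filter]
      refine Finset.card_le_card fun e he => ?_
      simp only [Finset.mem_filter, Finset.mem_univ, true_and] at he ⊢
      intro i hi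
      split_ifs with hi1
      · exact he.1 i hi1
      · exact he.2 i ((Finset.mem_union.1 hi).resolve_left hi1)
    rw [Finset.sum_congr rfl fun a _ => h1 a]
    refine le_trans ?_ (Nat.add_le_add_right (Finset.sum_le_sum h2) _)
    rw [Finset.sum_comm, Finset.sum_comm (s := P), ← Finset.sum_add_distrib]
    refine Finset.sum_le_sum fun e _ => ?_
    rw [← Finset.card_filter, ← Finset.card_filter]
    refine (card_le_card_pairs_add _ D (I e) fun a ha => hI e a (Finset.mem_filter.1 ha).2).trans
      (Nat.add_le_add_right (Finset.card_le_card fun x hx => ?_) _)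
    simp only [hP, Finset.mem_filter, Finset.mem_offDiag, Finset.mem_univ, true_and] at hx ⊢
    refine ⟨⟨hx.1.2.2, hx.2, fun i hi => ?_⟩, hx.1.1, hx.1.2.1⟩
    have hi' := Finset.mem_inter.1 hi
    exact (hx.1.1 i hi'.1).symm.trans (hx.1.2.1 i hi'.2)
  simp only [hpow]
  rw [← Finset.sum_div, ← Finset.sum_div, ← add_div]
  gcongr
  exact_mod_cast key

end FirstMoment

section Copies

/-- The increasing pairs of elements of `Fin k`. -/
abbrev OrdPair (k : ℕ) := {p : Fin k × Fin k // p.1 < p.2}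

lemma card_le_choose_two {k : ℕ} (R : Finset (OrdPair k)) (W : Finset (Fin k))
    (h : ∀ p ∈ R, p.1.1 ∈ W ∧ p.1.2 ∈ W) : R.card ≤ W.card.choose 2 := by
  rw [← card_cliqueEdges]
  refine Finset.card_le_card_of_injOn (fun p => s(p.1.1, p.1.2))
    (fun p hp => Finset.mem_coe.2
      (mk_mem_cliqueEdges.2 ⟨(h p hp).1, (h p hp).2, p.2.ne⟩)) fun p _ p' _ hpp => ?_
  rcases Sym2.eq_iff.1 hpp with ⟨h1, h2⟩ | ⟨h1, h2⟩
  · exact Subtype.ext (Prod.ext h1 h2)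
  · have h3 := p.2
    have h4 := p'.2
    rw [h1, h2] at h3
    exact absurd h3 h4.not_gt

lemma card_ordPair (k : ℕ) : Fintype.card (OrdPair k) = k.choose 2 := by
  refine le_antisymm ?_ ?_
  · simpa using card_le_choose_two (Finset.univ : Finset (OrdPair k)) Finset.univ (by simp)
  · have h : cliqueEdges (Finset.univ : Finset (Fin k)) ⊆
        (Finset.univ : Finset (OrdPair k)).image fun p => s(p.1.1, p.1.2) := by
      intro e
      induction e with
      | _ x y =>
        rw [mk_mem_cliqueEdges]
        rintro ⟨-, -, hxy⟩
        rcases lt_or_gt_of_ne hxy with h | h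
        · exact Finset.mem_image.2 ⟨⟨(x, y), h⟩, Finset.mem_univ _, rfl⟩
        · exact Finset.mem_image.2 ⟨⟨(y, x), h⟩, Finset.mem_univ _, Sym2.eq_swap⟩
    have := (Finset.card_le_card h).trans Finset.card_image_le
    simpa [card_cliqueEdges] using this

/-- The set of endpoints of a set of pairs. -/
def endpoints {k : ℕ} (R : Finset (OrdPair k)) : Finset (Fin k) :=
  R.image (fun p => p.1.1) ∪ R.image fun p => p.1.2

lemma left_mem_endpoints {k : ℕ} {R : Finset (OrdPair k)} {p : OrdPair k} (hp : p ∈ R) :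
    p.1.1 ∈ endpoints R :=
  Finset.mem_union_left _ (Finset.mem_image_of_mem _ hp)

lemma right_mem_endpoints {k : ℕ} {R : Finset (OrdPair k)} {p : OrdPair k} (hp : p ∈ R) :
    p.1.2 ∈ endpoints R :=
  Finset.mem_union_right _ (Finset.mem_image_of_mem _ hp)

lemma card_le_choose_endpoints {k : ℕ} (R : Finset (OrdPair k)) :
    R.card ≤ (endpoints R).card.choose 2 :=
  card_le_choose_two R _ fun _ hp => ⟨left_mem_endpoints hp, right_mem_endpoints hp⟩

lemma two_le_card_endpoints {k : ℕ} {R : Finset (OrdPair k)} (hR : R.Nonempty) :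
    2 ≤ (endpoints R).card := by
  obtain ⟨p, hp⟩ := hR
  exact Finset.one_lt_card.2 ⟨_, left_mem_endpoints hp, _, right_mem_endpoints hp, p.2.ne⟩

lemma mem_endpoints_univ {k : ℕ} (hk : 2 ≤ k) (v : Fin k) :
    v ∈ endpoints (Finset.univ : Finset (OrdPair k)) := by
  have : Nontrivial (Fin k) := Fin.nontrivial_iff_two_le.2 hk
  obtain ⟨w, hw⟩ := exists_ne v
  rcases lt_or_gt_of_ne hw with h | h
  · exact right_mem_endpoints (p := ⟨(w, v), h⟩) (Finset.mem_univ _)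
  · exact left_mem_endpoints (p := ⟨(v, w), h⟩) (Finset.mem_univ _)

/-- The graph of `r`, a choice of one of `m` attempts for each pair. -/
def slots {k m : ℕ} (r : OrdPair k → Fin m) : Finset (OrdPair k × Fin m) :=
  Finset.univ.image fun p => (p, r p)

lemma mem_slots {k m : ℕ} {r : OrdPair k → Fin m} {i : OrdPair k × Fin m} :
    i ∈ slots r ↔ r i.1 = i.2 := by
  obtain ⟨p, j⟩ := i
  simp [slots]

lemma card_slots {k m : ℕ} (r : OrdPair k → Fin m) : (slots r).card = k.choose 2 := by
  rw [slots, Finset.card_image_of_injective _ fun p q h => (Prod.mk.inj h).1, Finset.card_univ,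
    card_ordPair]

lemma card_slots_inter {k m : ℕ} (r r' : OrdPair k → Fin m) :
    (slots r ∩ slots r').card = (Finset.univ.filter fun p => r p = r' p).card := by
  rw [← Finset.card_image_of_injective (Finset.univ.filter fun p => r p = r' p)
    (f := fun p => (p, r p)) fun p q h => (Prod.mk.inj h).1]
  congr 1
  ext ⟨p, j⟩
  simp only [Finset.mem_inter, mem_slots, Finset.mem_image, Finset.mem_filter, Finset.mem_univ,
    true_and, Prod.mk.injEq]
  constructor
  · rintro ⟨h1, h2⟩
    exact ⟨p, h1.trans h2.symm, rfl, h1⟩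
  · rintro ⟨q, h1, rfl, h2⟩
    exact ⟨h2, h1.symm.trans h2⟩

lemma card_slots_union {k m : ℕ} (r r' : OrdPair k → Fin m) :
    (slots r ∪ slots r').card =
      k.choose 2 + (k.choose 2 - (Finset.univ.filter fun p => r p = r' p).card) := by
  have h1 := Finset.card_union_add_card_inter (slots r) (slots r')
  rw [card_slots, card_slots, card_slots_inter] at h1
  have h2 : (Finset.univ.filter fun p => r p = r' p).card ≤ k.choose 2 :=
    (Finset.card_le_univ _).trans_eq (card_ordPair k)
  omega

/-- The placement of the pair `p` prescribed by the placement `x` of the vertices. -/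
def place {k s : ℕ} (x : Fin k → Fin s) (p : OrdPair k) : Fin s × Fin s := (x p.1.1, x p.1.2)

/-- Two distinct copies of `K_k` that use a common slot and are compatible on their common slots. -/
def Conflict {k s m : ℕ} (z : ((Fin k → Fin s) × (OrdPair k → Fin m)) ×
    ((Fin k → Fin s) × (OrdPair k → Fin m))) : Prop :=
  z.1 ≠ z.2 ∧ (slots z.1.2 ∩ slots z.2.2).Nonempty ∧
    ∀ i ∈ slots z.1.2 ∩ slots z.2.2, place z.1.1 i.1 = place z.2.1 i.1

open Classical in
lemma sum_conflict_le {k : ℕ} (hk : 2 ≤ k) (s m : ℕ) {q : ℝ} (hq : 0 ≤ q) :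
    ∑ z : ((Fin k → Fin s) × (OrdPair k → Fin m)) × ((Fin k → Fin s) × (OrdPair k → Fin m))
        with Conflict z, q ^ (slots z.1.2 ∪ slots z.2.2).card ≤
      (s : ℝ) ^ k * (m * q) ^ k.choose 2 *
        ∑ R : Finset (OrdPair k) with R.Nonempty ∧ R ≠ Finset.univ,
          (s : ℝ) ^ (k - (endpoints R).card) * (m * q) ^ (k.choose 2 - R.card) := by
  set α := (Fin k → Fin s) × (OrdPair k → Fin m) with hα
  set agree : α × α → Finset (OrdPair k) := fun z => Finset.univ.filter fun p => z.1.2 p = z.2.2 p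
    with hagree
  have hmaps : ∀ z ∈ (Finset.univ.filter fun z : α × α => Conflict z), agree z ∈
      (Finset.univ.filter fun R : Finset (OrdPair k) => R.Nonempty ∧ R ≠ Finset.univ) := by
    intro z hz
    obtain ⟨hne, hnon, hpl⟩ := (Finset.mem_filter.1 hz).2
    refine Finset.mem_filter.2 ⟨Finset.mem_univ _, ?_, fun huniv => hne ?_⟩
    · rw [← Finset.card_pos, ← card_slots_inter, Finset.card_pos]
      exact hnon
    · have h2 : z.1.2 = z.2.2 := funext fun p => by
        have : p ∈ agree z := huniv ▸ Finset.mem_univ p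
        exact (Finset.mem_filter.1 this).2
      refine Prod.ext (funext fun v => ?_) h2
      have hpl' : ∀ p, place z.1.1 p = place z.2.1 p := fun p =>
        hpl (p, z.1.2 p) (Finset.mem_inter.2 ⟨mem_slots.2 rfl, mem_slots.2 (by rw [h2])⟩)
      rcases Finset.mem_union.1 (mem_endpoints_univ hk v) with hv | hv
      · obtain ⟨p, -, rfl⟩ := Finset.mem_image.1 hv
        exact (Prod.mk.inj (hpl' p)).1
      · obtain ⟨p, -, rfl⟩ := Finset.mem_image.1 hv
        exact (Prod.mk.inj (hpl' p)).2
  rw [← Finset.sum_fiberwise_of_maps_to hmaps, Finset.mul_sum]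
  refine Finset.sum_le_sum fun R hR => ?_
  have hcount : ((Finset.univ.filter fun z : α × α => Conflict z).filter
      fun z => agree z = R).card ≤
      s ^ k * m ^ k.choose 2 * (s ^ (k - (endpoints R).card) * m ^ (k.choose 2 - R.card)) := by
    have hsub : ((Finset.univ.filter fun z : α × α => Conflict z).filter fun z => agree z = R) ⊆
        (Finset.univ : Finset α).biUnion fun a =>
          ((Finset.univ.filter fun x : Fin k → Fin s => ∀ v ∈ endpoints R, x v = a.1 v) ×ˢ
            (Finset.univ.filter fun r : OrdPair k → Fin m => ∀ p ∈ R, r p = a.2 p)).image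
              fun a' => (a, a') := by
      intro z hz
      obtain ⟨hconf, rfl⟩ := Finset.mem_filter.1 hz
      obtain ⟨-, -, hpl⟩ := (Finset.mem_filter.1 hconf).2
      have hpl' : ∀ p ∈ agree z, place z.1.1 p = place z.2.1 p := fun p hp =>
        hpl (p, z.1.2 p) (Finset.mem_inter.2
          ⟨mem_slots.2 rfl, mem_slots.2 (Finset.mem_filter.1 hp).2.symm⟩)
      refine Finset.mem_biUnion.2 ⟨z.1, Finset.mem_univ _, Finset.mem_image.2
        ⟨z.2, Finset.mem_product.2 ⟨Finset.mem_filter.2 ⟨Finset.mem_univ _, fun v hv => ?_⟩,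
          Finset.mem_filter.2 ⟨Finset.mem_univ _, fun p hp => ?_⟩⟩, rfl⟩⟩
      · rcases Finset.mem_union.1 hv with hv | hv
        · obtain ⟨p, hp, rfl⟩ := Finset.mem_image.1 hv
          exact (Prod.mk.inj (hpl' p hp)).1.symm
        · obtain ⟨p, hp, rfl⟩ := Finset.mem_image.1 hv
          exact (Prod.mk.inj (hpl' p hp)).2.symm
      · exact (Finset.mem_filter.1 hp).2.symm
    refine (Finset.card_le_card hsub).trans (Finset.card_biUnion_le.trans ?_)
    have hα' : Fintype.card α = s ^ k * m ^ k.choose 2 := by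
      simp [hα, Fintype.card_prod, card_ordPair]
    rw [← hα', ← Finset.card_univ, ← smul_eq_mul]
    refine Finset.sum_le_card_nsmul _ _ _ fun a _ => Finset.card_image_le.trans ?_
    rw [Finset.card_product]
    refine (congrArg₂ (· * ·) ?_ ?_).le
    · have := card_filter_agree (endpoints R) a.1
      rw [Fintype.card_fin, Fintype.card_fin] at this
      convert this
    · have := card_filter_agree R a.2
      rw [Fintype.card_fin, card_ordPair] at this
      convert this
  rw [Finset.sum_congr rfl fun z hz => show _ = q ^ (k.choose 2 + (k.choose 2 - R.card)) by
    rw [card_slots_union, ← (Finset.mem_filter.1 hz).2], Finset.sum_const, nsmul_eq_mul]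
  calc _ ≤ ((s ^ k * m ^ k.choose 2 *
        (s ^ (k - (endpoints R).card) * m ^ (k.choose 2 - R.card)) : ℕ) : ℝ) *
          q ^ (k.choose 2 + (k.choose 2 - R.card)) := by
        gcongr
    _ = _ := by
        push_cast
        rw [pow_add, mul_pow, mul_pow]
        ring

end Copies

section MakerWins

/-- `M` contains a copy of `K_k` with one vertex in each row of the grid embedded by `vtx`. -/
def HasGridClique {k s n : ℕ} (vtx : Fin k × Fin s ↪ Fin n) (M : Finset (Sym2 (Fin n))) : Prop :=
  ∃ x : Fin k → Fin s, ∀ p : OrdPair k, s(vtx (p.1.1, x p.1.1), vtx (p.1.2, x p.1.2)) ∈ M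

open Classical in
lemma copies_le_of_not_makerWin {k s m n b : ℕ} (hk : 2 ≤ k) (hs : 0 < s)
    (vtx : Fin k × Fin s ↪ Fin n)
    (hM : ¬ MakerWin (completeEdges n) (HasGridClique vtx) b ∅ ∅)
    (hN : k.choose 2 * m * (b + 1) ≤ s * s) {p : ℝ} (hp : p = m * ((s * s : ℕ) : ℝ)⁻¹) :
    (s : ℝ) ^ k * p ^ k.choose 2 ≤ (s : ℝ) ^ k * p ^ k.choose 2 *
        (∑ R : Finset (OrdPair k) with R.Nonempty ∧ R ≠ Finset.univ,
          (s : ℝ) ^ (k - (endpoints R).card) * p ^ (k.choose 2 - R.card)) +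
      (k.choose 2 : ℝ) ^ 2 * p ^ 2 * s ^ 2 * b := by
  have : Nonempty (Fin s) := ⟨⟨0, hs⟩⟩
  have hcard : Fintype.card (OrdPair k × Fin m) = k.choose 2 * m := by
    rw [Fintype.card_prod, card_ordPair, Fintype.card_fin]
  have hΩ : Fintype.card (Fin s × Fin s) = s * s := by
    rw [Fintype.card_prod, Fintype.card_fin]
  obtain ⟨I, hI, hIsum⟩ := exists_failure_sets_of_fintype
    (fun (i : OrdPair k × Fin m) (ω : Fin s × Fin s) =>
      s(vtx (i.1.1.1, ω.1), vtx (i.1.1.2, ω.2)))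
    (fun i ω ω' hω => by
      rcases Sym2.eq_iff.1 hω with ⟨h1, h2⟩ | ⟨h1, h2⟩
      · exact Prod.ext (Prod.mk.inj (vtx.injective h1)).2 (Prod.mk.inj (vtx.injective h2)).2
      · exact absurd (Prod.mk.inj (vtx.injective h1)).1 i.1.2.ne)
    (fun i ω => by
      simp only [completeEdges, Finset.mem_filter, Finset.mem_univ, true_and, Sym2.mk_isDiag_iff]
      exact fun h => i.1.2.ne (Prod.mk.inj (vtx.injective h)).1)
    hM (by rw [hcard, hΩ]; exact hN)
  have key := sum_inv_pow_le (fun a : (Fin k → Fin s) × (OrdPair k → Fin m) => slots a.2)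
    (fun a i => place a.1 i.1) I (fun e a ha => by
      obtain ⟨M', hM', he⟩ := hI e
      by_contra hcon
      refine hM' ⟨a.1, fun p => ?_⟩
      have h1 : (p, a.2 p) ∈ slots a.2 := mem_slots.2 rfl
      have h2 := he (p, a.2 p) fun h => hcon ⟨_, Finset.mem_inter.2 ⟨h1, h⟩⟩
      rw [ha _ h1] at h2
      exact h2)
  have hconf := sum_conflict_le hk s m (q := ((s * s : ℕ) : ℝ)⁻¹) (by positivity)
  rw [hΩ] at key hIsum
  rw [hcard] at key hIsum
  rw [← hp] at hconf
  have hs' : (0 : ℝ) < s := by exact_mod_cast hs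
  have hfail : ((∑ e, (I e).card : ℕ) : ℝ) / ((s * s : ℕ) : ℝ) ^ (k.choose 2 * m) ≤
      (k.choose 2 : ℝ) ^ 2 * p ^ 2 * s ^ 2 * b := by
    rw [div_le_iff₀ (by positivity)]
    have h1 : ((∑ e, (I e).card : ℕ) : ℝ) * (s * s) ≤
        (k.choose 2 * m) * ((k.choose 2 * m) * b) * ((s * s : ℕ) : ℝ) ^ (k.choose 2 * m) := by
      exact_mod_cast hIsum
    rw [← le_div_iff₀ (by positivity)] at h1
    refine h1.trans_eq ?_
    rw [hp]
    push_cast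
    field_simp
  have hleft : ∑ a : (Fin k → Fin s) × (OrdPair k → Fin m),
      (((s * s : ℕ) : ℝ)⁻¹) ^ (slots a.2).card = (s : ℝ) ^ k * p ^ k.choose 2 := by
    simp only [card_slots, Finset.sum_const, Finset.card_univ, nsmul_eq_mul, Fintype.card_prod,
      Fintype.card_fun, Fintype.card_fin, card_ordPair]
    rw [hp, mul_pow]
    push_cast
    ring
  rw [hleft] at key
  refine key.trans (add_le_add ?_ hfail)
  refine le_trans (le_of_eq (Finset.sum_congr ?_ fun _ _ => rfl)) hconf
  ext z
  simp [Conflict]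

lemma sum_endpoints_le {k : ℕ} {y p a : ℝ} (hy : 1 ≤ y) (hp0 : 0 ≤ p) (hp : p ≤ a / y ^ 2)
    (ha0 : 0 < a) (ha1 : a ≤ 1) :
    ∑ R : Finset (OrdPair k) with R.Nonempty ∧ R ≠ Finset.univ,
      (y ^ (k + 1)) ^ (k - (endpoints R).card) * p ^ (k.choose 2 - R.card) ≤
        2 ^ k.choose 2 * a := by
  have hpa : p ≤ a := hp.trans (div_le_self ha0.le (one_le_pow₀ hy))
  have hterm : ∀ R ∈ (Finset.univ.filter fun R : Finset (OrdPair k) =>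
      R.Nonempty ∧ R ≠ Finset.univ),
      (y ^ (k + 1)) ^ (k - (endpoints R).card) * p ^ (k.choose 2 - R.card) ≤ a := by
    intro R hR
    obtain ⟨hne, huniv⟩ := (Finset.mem_filter.1 hR).2
    have hle : (endpoints R).card ≤ k := by simpa using Finset.card_le_univ (endpoints R)
    rcases hle.eq_or_lt with heq | hlt
    · have hRlt : R.card < k.choose 2 := by
        rw [← card_ordPair k]
        exact Finset.card_lt_univ_of_notMem
          (by simpa [Finset.eq_univ_iff_forall] using huniv : ∃ x, x ∉ R).choose_spec
      rw [heq, Nat.sub_self, pow_zero, one_mul]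
      exact (pow_le_of_le_one hp0 (hpa.trans ha1) (by omega)).trans hpa
    · have h1 := pow_mul_pow_le (D := a⁻¹) (two_le_card_endpoints hne) hlt hy
        ((one_le_inv₀ ha0).2 ha1) hp0 (by rwa [mul_inv, inv_inv, ← div_eq_mul_inv])
      have h2 : p ^ (k.choose 2 - R.card) ≤ p ^ (k.choose 2 - (endpoints R).card.choose 2) :=
        pow_le_pow_of_le_one hp0 (hpa.trans ha1)
          (Nat.sub_le_sub_left (card_le_choose_endpoints R) _)
      rw [inv_inv] at h1
      calc _ ≤ (y ^ (k + 1)) ^ (k - (endpoints R).card) *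
            p ^ (k.choose 2 - (endpoints R).card.choose 2) := by gcongr
        _ ≤ _ := h1
        _ ≤ a := mul_le_of_le_one_right ha0.le (inv_le_one_of_one_le₀ (one_le_pow₀ hy))
  refine (Finset.sum_le_card_nsmul _ _ _ hterm).trans ?_
  rw [nsmul_eq_mul]
  gcongr
  have := Finset.card_filter_le (Finset.univ : Finset (Finset (OrdPair k)))
    fun R => R.Nonempty ∧ R ≠ Finset.univ
  rw [Finset.card_univ, Fintype.card_finset, card_ordPair] at this
  exact_mod_cast this

lemma exists_orientation {k s n : ℕ} {T : Fin k → Fin k → Prop} (hT : IsTournament T)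
    (vtx : Fin k × Fin s ↪ Fin n) :
    ∃ o : Sym2 (Fin n) → Fin n × Fin n, (∀ e, s((o e).1, (o e).2) = e) ∧
      ∀ i j u v, T i j → o s(vtx (i, u), vtx (j, v)) = (vtx (i, u), vtx (j, v)) := by
  have h : ∀ e : Sym2 (Fin n), ∃ z : Fin n × Fin n, s(z.1, z.2) = e ∧
      ∀ i j u v, T i j → s(vtx (i, u), vtx (j, v)) = e → z = (vtx (i, u), vtx (j, v)) := by
    intro e
    by_cases he : ∃ i j u v, T i j ∧ s(vtx (i, u), vtx (j, v)) = e
    · obtain ⟨i, j, u, v, hij, rfl⟩ := he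
      refine ⟨(vtx (i, u), vtx (j, v)), rfl, fun i' j' u' v' hij' heq => ?_⟩
      rcases Sym2.eq_iff.1 heq with ⟨h1, h2⟩ | ⟨h1, h2⟩
      · rw [h1, h2]
      · obtain rfl := (Prod.mk.inj (vtx.injective h1)).1
        obtain rfl := (Prod.mk.inj (vtx.injective h2)).1
        have hne : i' ≠ j' := fun h => hT.1 i' (by rw [← h] at hij'; exact hij')
        exact absurd hij ((hT.2 i' j' hne).1 hij')
    · induction e with
      | _ x y => exact ⟨(x, y), rfl, fun i j u v hij heq => absurd ⟨i, j, u, v, hij, heq⟩ he⟩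
  choose o ho ho' using h
  exact ⟨o, ho, fun i j u v hij => ho' _ i j u v hij rfl⟩

lemma hasTCopy_image_of_hasGridClique {k s n : ℕ} {T : Fin k → Fin k → Prop}
    (hT : IsTournament T) {vtx : Fin k × Fin s ↪ Fin n} {o : Sym2 (Fin n) → Fin n × Fin n}
    (ho : ∀ i j u v, T i j → o s(vtx (i, u), vtx (j, v)) = (vtx (i, u), vtx (j, v)))
    {M : Finset (Sym2 (Fin n))} (hM : HasGridClique vtx M) : HasTCopy T (M.image o) := by
  obtain ⟨x, hx⟩ := hM
  refine ⟨fun i => vtx (i, x i), fun i j hij => (Prod.mk.inj (vtx.injective hij)).1,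
    fun i j hij => Finset.mem_image.2 ⟨s(vtx (i, x i), vtx (j, x j)), ?_, ho i j _ _ hij⟩⟩
  have hne : i ≠ j := fun h => hT.1 i (by rw [← h] at hij; exact hij)
  rcases lt_or_gt_of_ne hne with h | h
  · exact hx ⟨(i, j), h⟩
  · rw [Sym2.eq_swap]
    exact hx ⟨(j, i), h⟩

lemma makerWin_gridClique {k s n b : ℕ} (hk : 3 ≤ k) (hs : 0 < s)
    (vtx : Fin k × Fin s ↪ Fin n) {a y : ℝ} (hy : (s : ℝ) = y ^ (k + 1))
    (ha : a = (2 ^ (k.choose 2 + 1))⁻¹) (hay : 1 ≤ a * y) (hb1 : 1 ≤ b)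
    (hb : 4 * (k.choose 2 : ℝ) ^ 2 * b ≤ (a / 2) ^ (k.choose 2 - 2) * y ^ 2) :
    MakerWin (completeEdges n) (HasGridClique vtx) b ∅ ∅ := by
  by_contra hM
  have hl := two_mul_choose_sub (j := 2) le_rfl (by omega : 2 ≤ k)
  have hl3 : 3 ≤ k.choose 2 := by simpa using Nat.choose_le_choose 2 hk
  rw [Nat.sub_self, mul_zero, add_zero, Nat.choose_self] at hl
  set l := k.choose 2 with hldef
  have ha0 : 0 < a := by rw [ha]; positivity
  have ha1 : a ≤ 1 := by
    rw [ha]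
    exact inv_le_one_of_one_le₀ (one_le_pow₀ (by norm_num))
  have hy1 : 1 ≤ y := by
    have hy0 : 0 < y := pos_of_mul_pos_right (by linarith) ha0.le
    nlinarith
  have hs' : (0 : ℝ) < s := by exact_mod_cast hs
  have hl' : (3 : ℝ) ≤ l := by exact_mod_cast hl3
  have hb1' : (1 : ℝ) ≤ b := by exact_mod_cast hb1
  set x : ℝ := a * s ^ 2 / y ^ 2 with hx
  set m := ⌊x⌋₊ with hm
  have hx1 : 1 ≤ x := by
    rw [hx, le_div_iff₀ (by positivity), hy, one_mul]
    have h1 : y ^ 2 ≤ y ^ (k + 1) := pow_le_pow_right₀ hy1 (by omega)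
    have h2 : y ≤ y ^ (k + 1) := le_self_pow₀ hy1 (by omega)
    nlinarith [mul_le_mul h1 h2 (by linarith) (by positivity)]
  have hmx : (m : ℝ) ≤ x := Nat.floor_le (by linarith)
  have hxm : x ≤ 2 * m := by
    have h1 := Nat.lt_floor_add_one x
    have h2 : (1 : ℝ) ≤ m := by exact_mod_cast Nat.le_floor (by exact_mod_cast hx1)
    linarith
  set p : ℝ := m * ((s * s : ℕ) : ℝ)⁻¹ with hp
  have hpm : p * s ^ 2 = m := by
    rw [hp]
    push_cast
    field_simp
  have hp_le : p ≤ a / y ^ 2 := by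
    refine le_of_mul_le_mul_right ?_ (by positivity : (0 : ℝ) < s ^ 2)
    rw [hpm, div_mul_eq_mul_div]
    exact hmx
  have hp_ge : a / 2 / y ^ 2 ≤ p := by
    refine le_of_mul_le_mul_right ?_ (by positivity : (0 : ℝ) < s ^ 2)
    rw [hpm]
    have : a / 2 / y ^ 2 * (s : ℝ) ^ 2 = x / 2 := by rw [hx]; ring
    linarith
  have hp0 : 0 < p := lt_of_lt_of_le (by positivity) hp_ge
  have hpow1 : (a / 2) ^ (l - 2) ≤ 1 := pow_le_one₀ (by positivity) (by linarith)
  have hbnd : 4 * (l : ℝ) ^ 2 * b ≤ y ^ 2 :=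
    hb.trans (mul_le_of_le_one_left (by positivity) hpow1)
  have hN : l * m * (b + 1) ≤ s * s := by
    have : (l * m * (b + 1) : ℝ) ≤ s * s := by
      calc (l * m * (b + 1) : ℝ) ≤ l * x * (2 * b) := by gcongr; linarith
        _ = (2 * l * b) * a * (s ^ 2 / y ^ 2) := by rw [hx]; ring
        _ ≤ y ^ 2 * 1 * (s ^ 2 / y ^ 2) := by
            gcongr
            nlinarith
        _ = s * s := by field_simp
    exact_mod_cast this
  have key := copies_le_of_not_makerWin (by omega) hs vtx hM hN hp
  rw [← hldef] at key
  have hsum := sum_endpoints_le (k := k) hy1 hp0.le hp_le ha0 ha1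
  rw [← hy, ← hldef] at hsum
  have hhalf : (2 : ℝ) ^ l * a = 1 / 2 := by
    rw [ha, pow_succ]
    field_simp
  rw [hhalf] at hsum
  have h1 : (s : ℝ) ^ k * p ^ l ≤ 2 * ((l : ℝ) ^ 2 * p ^ 2 * s ^ 2 * b) := by
    have := mul_le_mul_of_nonneg_left hsum (by positivity : 0 ≤ (s : ℝ) ^ k * p ^ l)
    linarith
  have h2 : (s : ℝ) ^ (k - 2) * p ^ (l - 2) ≤ 2 * (l : ℝ) ^ 2 * b := by
    have e1 : (s : ℝ) ^ k = s ^ (k - 2) * s ^ 2 := by rw [← pow_add]; congr 1; omega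
    have e2 : p ^ l = p ^ (l - 2) * p ^ 2 := by rw [← pow_add]; congr 1; omega
    rw [e1, e2] at h1
    refine le_of_mul_le_mul_right ?_ (by positivity : 0 < (s : ℝ) ^ 2 * p ^ 2)
    linarith
  have h3 : (a / 2) ^ (l - 2) * y ^ 2 ≤ (s : ℝ) ^ (k - 2) * p ^ (l - 2) := by
    calc (a / 2) ^ (l - 2) * y ^ 2
        = (s : ℝ) ^ (k - 2) * (a / 2 / y ^ 2) ^ (l - 2) := by
          have e : (k + 1) * (k - 2) = 2 * (l - 2) + 2 := by
            rw [mul_comm, ← hl]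
            omega
          rw [hy, ← pow_mul, e, div_pow (a / 2), pow_add, ← pow_mul]
          field_simp
      _ ≤ _ := by gcongr
  have h4 : 0 < (l : ℝ) ^ 2 * b := by positivity
  linarith

theorem maker_wins (k : ℕ) (hk : 3 ≤ k) (T : Fin k → Fin k → Prop) (hT : IsTournament T) :
    ∃ c : ℝ, 0 < c ∧ ∃ n₀ : ℕ, ∀ n : ℕ, n₀ ≤ n → ∀ b : ℕ, 1 ≤ b →
      (b : ℝ) ≤ c * (n : ℝ) ^ (2 / (k + 1 : ℝ)) →
        OMakerWin (completeEdges n) (HasTCopy T) b ∅ ∅ := by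
  have hl3 : 3 ≤ k.choose 2 := by simpa using Nat.choose_le_choose 2 hk
  set l := k.choose 2 with hl
  set a : ℝ := (2 ^ (l + 1))⁻¹ with ha
  have ha0 : 0 < a := by positivity
  have hk0 : (0 : ℝ) < k := by exact_mod_cast (by omega : 0 < k)
  have hk3 : (3 : ℝ) ≤ k := by exact_mod_cast hk
  have hl0 : (0 : ℝ) < l := by exact_mod_cast (by omega : 0 < l)
  refine ⟨(a / 2) ^ (l - 2) / (8 * k * l ^ 2), by positivity,
    k * (2 ^ (l + 1)) ^ (k + 1), fun n hn b hb1 hb => ?_⟩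
  set s := n / k with hs
  have hs1 : (2 ^ (l + 1)) ^ (k + 1) ≤ s := (Nat.le_div_iff_mul_le (by omega)).2 (by linarith)
  have hs0 : 0 < s := lt_of_lt_of_le (by positivity) hs1
  have hns : n ≤ 2 * k * s := by
    have h1 := Nat.lt_mul_div_succ n (by omega : 0 < k)
    rw [← hs] at h1
    nlinarith
  have hsn : Fintype.card (Fin k × Fin s) ≤ Fintype.card (Fin n) := by
    rw [Fintype.card_prod, Fintype.card_fin, Fintype.card_fin, Fintype.card_fin]
    exact Nat.mul_div_le n k
  obtain ⟨vtx⟩ := Function.Embedding.nonempty_of_card_le hsn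
  obtain ⟨o, ho, hoT⟩ := exists_orientation hT vtx
  set y : ℝ := (s : ℝ) ^ (1 / (k + 1 : ℝ)) with hy
  have hay : 1 ≤ a * y := by
    rw [ha, ← div_eq_inv_mul, one_le_div (by positivity), hy, one_div]
    have h1 : (((2 : ℝ) ^ (l + 1)) ^ (k + 1)) ≤ s := by exact_mod_cast hs1
    have h2 := Real.rpow_le_rpow (by positivity) h1 (by positivity : 0 ≤ ((k + 1 : ℕ) : ℝ)⁻¹)
    rw [Real.pow_rpow_inv_natCast (by positivity) (by omega)] at h2
    exact_mod_cast h2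
  have hpow : (n : ℝ) ^ (2 / (k + 1 : ℝ)) ≤ 2 * k * y ^ 2 := by
    have h1 : (n : ℝ) ≤ 2 * k * s := by exact_mod_cast hns
    calc (n : ℝ) ^ (2 / (k + 1 : ℝ)) ≤ (2 * k * s : ℝ) ^ (2 / (k + 1 : ℝ)) := by gcongr
      _ = (2 * k : ℝ) ^ (2 / (k + 1 : ℝ)) * (s : ℝ) ^ (2 / (k + 1 : ℝ)) :=
          Real.mul_rpow (by positivity) (by positivity)
      _ ≤ 2 * k * y ^ 2 := by
          rw [rpow_two_div k s]
          gcongr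
          refine Real.rpow_le_self_of_one_le (by linarith) ?_
          rw [div_le_one (by positivity)]
          linarith
  have hwin := makerWin_gridClique hk hs0 vtx (rpow_one_div_pow k s) ha hay hb1 (by
    have h1 : (b : ℝ) ≤ (a / 2) ^ (l - 2) / (8 * k * l ^ 2) * (2 * k * y ^ 2) :=
      hb.trans (by gcongr)
    calc 4 * (k.choose 2 : ℝ) ^ 2 * b
        ≤ 4 * (l : ℝ) ^ 2 * ((a / 2) ^ (l - 2) / (8 * k * l ^ 2) * (2 * k * y ^ 2)) := by gcongr
      _ = (a / 2) ^ (l - 2) * y ^ 2 := by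
          field_simp
          ring)
  simpa using MakerWin.oriented o ho (fun M => hasTCopy_image_of_hasGridClique hT hoT) hwin

end MakerWins

/-- For every tournament `T` on `k ≥ 3` vertices, the threshold bias for
the `(1:b)` `T`-tournament game on `K_n` is `Θ(n^{2/(k+1)})`. -/
theorem tournament_threshold_bias (k : ℕ) (hk : 3 ≤ k)
    (T : Fin k → Fin k → Prop) (hT : IsTournament T) :
    ∃ c C : ℝ, 0 < c ∧ 0 < C ∧ ∃ n₀ : ℕ, ∀ n : ℕ, n₀ ≤ n →
      (∀ b : ℕ, 1 ≤ b → (b : ℝ) ≤ c * (n : ℝ) ^ (2 / (k + 1 : ℝ)) →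
        OMakerWin (completeEdges n) (HasTCopy T) b ∅ ∅) ∧
      (∀ b : ℕ, C * (n : ℝ) ^ (2 / (k + 1 : ℝ)) ≤ (b : ℝ) →
        OBreakerBlock (completeEdges n) (HasTCopy T) b ∅ ∅) := by
  obtain ⟨c, hc, n₁, hmaker⟩ := maker_wins k hk T hT
  obtain ⟨C, hC, n₂, hbreaker⟩ := breaker_wins k hk T hT
  exact ⟨c, C, hc, hC, max n₁ n₂, fun n hn => ⟨hmaker n ((le_max_left _ _).trans hn),
    hbreaker n ((le_max_right _ _).trans hn)⟩⟩

end TournamentGame
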